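/- The set of subfields F of the algebraic closure of ℚ that are PAC, i.e., such that every absolutely irreducible polynomial f ∈ F[X,Y] has a zero in F × F, is a dense G_δ subset (in particular a comeager subset) of the space 𝓔 of all subfields of the algebraic closure of ℚ. -/

import Mathlib

open FirstOrder Topology

noncomputable section

/-- `Q̄`, the algebraic closure of `ℚ`. -/
abbrev Qbar : Type := AlgebraicClosure ℚ

/-- `Prop` with the discrete two-point topology. -/
def propDiscrete : TopologicalSpace Prop := ⊥

/-- The product topology on the powerset `2^Q̄`, identified with `Set Q̄ = Q̄ → Prop`,
where each factor `Prop` carries the discrete two-point topology. -/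
def powersetTopology : TopologicalSpace (Set Qbar) :=
  @Pi.topologicalSpace Qbar (fun _ => Prop) (fun _ => propDiscrete)

/-- The space `𝓔` of all subfields of `Q̄`, with the subspace topology induced from `2^Q̄`
via the identification of a subfield with its underlying set of elements. -/
instance subfieldTopology : TopologicalSpace (Subfield Qbar) :=
  powersetTopology.induced (fun F => (F : Set Qbar))

/-- A subfield `F` of `Q̄` is PAC if every polynomial `f ∈ F[X,Y]` that is absolutely
irreducible (i.e. whose image in `Q̄[X,Y]` is irreducible) has a zero `(x,y) ∈ F × F`. -/
def IsPAC (F : Subfield Qbar) : Prop :=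
  ∀ f : MvPolynomial (Fin 2) F,
    Irreducible (MvPolynomial.map F.subtype f) →
    ∃ x y : F, MvPolynomial.eval ![x, y] f = 0

section

open Polynomial Filter

section RealAnalysis

/-- Iterated Rolle theorem for a sequence of successive derivatives on a half-line. -/
theorem exists_deriv_seq_eq_zero {a : ℝ} (k : ℕ) (g : ℕ → ℝ → ℝ)
    (hg : ∀ j, ∀ t, a < t → HasDerivAt (g j) (g (j + 1) t) t) (s : Finset ℝ)
    (hs : ∀ t ∈ s, a < t) (hcard : s.card = k + 1) (hz : ∀ t ∈ s, g 0 t = 0) :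
    ∃ ξ, a < ξ ∧ g k ξ = 0 := by
  induction k generalizing g s with
  | zero =>
    obtain ⟨t, rfl⟩ := Finset.card_eq_one.mp hcard
    exact ⟨t, hs t (by simp), hz t (by simp)⟩
  | succ k ih =>
    set e := s.orderEmbOfFin hcard with he
    have hmem : ∀ i, e i ∈ s := fun i => Finset.orderEmbOfFin_mem s hcard i
    have hlt : ∀ i : Fin (k + 1), e i.castSucc < e i.succ := fun i =>
      e.strictMono Fin.castSucc_lt_succ
    have hc : ∀ i : Fin (k + 1), ∃ c ∈ Set.Ioo (e i.castSucc) (e i.succ), g 1 c = 0 := by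
      intro i
      refine exists_hasDerivAt_eq_zero (f := g 0) (hlt i) ?_ ?_ ?_
      · intro t ht
        exact (hg 0 t ((hs _ (hmem _)).trans_le ht.1)).continuousAt.continuousWithinAt
      · rw [hz _ (hmem _), hz _ (hmem _)]
      · intro t ht
        exact hg 0 t ((hs _ (hmem _)).trans ht.1)
    choose c hc hc0 using hc
    have hmono : StrictMono c := by
      rw [Fin.strictMono_iff_lt_succ]
      intro i
      exact (hc i.castSucc).2.trans (hc i.succ).1
    refine ih (fun j => g (j + 1)) (fun j t ht => hg (j + 1) t ht) (Finset.univ.image c) ?_ ?_ ?_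
    · intro t ht
      obtain ⟨i, -, rfl⟩ := Finset.mem_image.mp ht
      exact (hs _ (hmem _)).trans (hc i).1
    · rw [Finset.card_image_of_injective _ hmono.injective]; simp
    · intro t ht
      obtain ⟨i, -, rfl⟩ := Finset.mem_image.mp ht
      exact hc0 i

/-- Mean value theorem for divided differences. -/
theorem exists_deriv_seq_eq_coeff {a : ℝ} (k : ℕ) (g : ℕ → ℝ → ℝ)
    (hg : ∀ j, ∀ t, a < t → HasDerivAt (g j) (g (j + 1) t) t) (s : Finset ℝ)
    (hs : ∀ t ∈ s, a < t) (hcard : s.card = k + 1) :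
    ∃ ξ, a < ξ ∧ g k ξ = k.factorial * (Lagrange.interpolate s id (g 0)).coeff k := by
  set P := Lagrange.interpolate s id (g 0) with hP
  have hinj : Set.InjOn (id : ℝ → ℝ) s := Function.injective_id.injOn
  obtain ⟨ξ, hξ, h0⟩ := exists_deriv_seq_eq_zero k
    (fun j t => g j t - (derivative^[j] P).eval t)
    (fun j t ht => by
      rw [Function.iterate_succ_apply']
      exact (hg j t ht).sub (Polynomial.hasDerivAt _ t)) s hs hcard
    (fun t ht => by
      have := Lagrange.eval_interpolate_at_node (r := g 0) hinj ht
      simp only [id] at this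
      simp only [Function.iterate_zero, id, hP, this, sub_self])
  refine ⟨ξ, hξ, ?_⟩
  have hdeg : P.natDegree ≤ k := by
    have := Lagrange.degree_interpolate_le (r := g 0) hinj
    rw [hcard] at this
    exact Polynomial.natDegree_le_of_degree_le this
  have hd0 : (derivative^[k] P).natDegree ≤ 0 := by
    have := Polynomial.natDegree_iterate_derivative P k
    omega
  rw [sub_eq_zero] at h0
  rw [h0, Polynomial.eq_C_of_natDegree_le_zero hd0, Polynomial.eval_C,
    Polynomial.coeff_iterate_derivative, zero_add, Nat.descFactorial_self, nsmul_eq_mul]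

end RealAnalysis

section Sparse

/-- The sequence `h`, `M h - s h'`, ... governing the derivatives of `t ^ M * h (1 / t)`. -/
def tailSeq (h : ℝ → ℝ) (M : ℕ) : ℕ → ℝ → ℝ
  | 0 => h
  | j + 1 => fun s => ((M : ℝ) - j) * tailSeq h M j s - s * deriv (tailSeq h M j) s

theorem tailSeq_analyticOnNhd {h : ℝ → ℝ} (M : ℕ) {U : Set ℝ} (hh : AnalyticOnNhd ℝ h U) (j : ℕ) :
    AnalyticOnNhd ℝ (tailSeq h M j) U := by
  induction j with
  | zero => exact hh
  | succ j ih =>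
    exact (analyticOnNhd_const.mul ih).sub (analyticOnNhd_id.mul ih.deriv)

theorem hasDerivAt_zpow_mul_tailSeq {h : ℝ → ℝ} (M : ℕ) (j : ℕ) {t : ℝ} (ht : t ≠ 0)
    (hd : AnalyticAt ℝ (tailSeq h M j) t⁻¹) :
    HasDerivAt (fun t : ℝ => t ^ ((M : ℤ) - j) * tailSeq h M j t⁻¹)
      (t ^ ((M : ℤ) - (j + 1 : ℕ)) * tailSeq h M (j + 1) t⁻¹) t := by
  have h1 := hasDerivAt_zpow ((M : ℤ) - j) t (Or.inl ht)
  have h2 := hd.differentiableAt.hasDerivAt.comp t (hasDerivAt_inv ht)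
  refine (h1.mul h2).congr_deriv ?_
  have e : t ^ ((M : ℤ) - j) = t ^ ((M : ℤ) - (j + 1 : ℕ)) * t := by
    rw [← zpow_add_one₀ ht]; congr 1; push_cast; ring
  have e' : t ^ ((M : ℤ) - j - 1) = t ^ ((M : ℤ) - (j + 1 : ℕ)) := by
    congr 1; push_cast; ring
  simp only [tailSeq, Function.comp]
  rw [e', e]
  generalize t ^ ((M : ℤ) - (j + 1 : ℕ)) = u
  push_cast
  field_simp
  ring

/-- A function which is integral at the nodes `s`, pairwise at distance at most `H`, has leading
interpolation coefficient with denominator bounded in terms of `H`. -/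
theorem exists_int_eq_factorial_pow_mul_coeff_interpolate (k H T : ℕ) (s : Finset ℕ)
    (hs : s ⊆ Finset.Icc T (T + H)) (hcard : s.card = k + 1) (φ : ℝ → ℝ)
    (hφ : ∀ n ∈ s, ∃ z : ℤ, φ n = z) :
    ∃ z : ℤ, ((H.factorial : ℝ) ^ k) *
      (Lagrange.interpolate (s.image (Nat.cast : ℕ → ℝ)) id φ).coeff k = z := by
  classical
  have hci : Function.Injective (Nat.cast : ℕ → ℝ) := Nat.cast_injective
  set S := s.image (Nat.cast : ℕ → ℝ) with hS
  have hinj : Set.InjOn (id : ℝ → ℝ) S := Function.injective_id.injOn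
  have hScard : S.card = k + 1 := by rw [hS, Finset.card_image_of_injective _ hci, hcard]
  have hco := Lagrange.coeff_eq_sum hinj (Lagrange.degree_interpolate_lt (r := φ) hinj)
  rw [hScard, Nat.add_sub_cancel] at hco
  rw [hco, Finset.mul_sum]
  have hmem : ∀ x : ℝ, x ∈ (Int.castRingHom ℝ).range ↔ ∃ z : ℤ, x = z := fun x =>
    ⟨fun ⟨z, hz⟩ => ⟨z, by simpa using hz.symm⟩, fun ⟨z, hz⟩ => ⟨z, by simpa using hz.symm⟩⟩
  rw [← hmem]
  refine Subring.sum_mem _ fun x hx => ?_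
  obtain ⟨n, hn, rfl⟩ := Finset.mem_image.mp hx
  have hev := Lagrange.eval_interpolate_at_node (r := φ) hinj hx
  simp only [id] at hev ⊢
  rw [hev, mul_div_assoc', mul_comm, mul_div_assoc]
  refine Subring.mul_mem _ ((hmem _).mpr (hφ n hn)) ?_
  have hcc : (S.erase (n : ℝ)).card = k := by rw [Finset.card_erase_of_mem hx, hScard]; simp
  have : (H.factorial : ℝ) ^ k = ∏ _j ∈ S.erase (n : ℝ), (H.factorial : ℝ) := by
    rw [Finset.prod_const, hcc]
  rw [this, ← Finset.prod_div_distrib]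
  refine Subring.prod_mem _ fun y hy => ?_
  obtain ⟨hne, hy⟩ := Finset.mem_erase.mp hy
  obtain ⟨m, hm, rfl⟩ := Finset.mem_image.mp hy
  have hnm : (n : ℤ) - m ≠ 0 := by
    intro h0; apply hne; have : n = m := by omega
    rw [this]
  have hdvd : ((n : ℤ) - m) ∣ (H.factorial : ℤ) := by
    have h1 := Finset.mem_Icc.mp (hs hn)
    have h2 := Finset.mem_Icc.mp (hs hm)
    rw [← Int.natAbs_dvd, Int.natCast_dvd_natCast]
    exact Nat.dvd_factorial (by omega) (by omega)
  obtain ⟨c, hc⟩ := hdvd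
  rw [hmem]
  refine ⟨c, ?_⟩
  have hc' : (H.factorial : ℝ) = ((n : ℝ) - m) * c := by exact_mod_cast congrArg (Int.cast : ℤ → ℝ) hc
  have hnm' : (n : ℝ) - m ≠ 0 := by exact_mod_cast hnm
  rw [hc']; field_simp

/-- If `h` is real analytic at `0` and `t ^ M * h (1 / t)` takes integral values at many integers,
then it is a rational polynomial near infinity. -/
theorem card_integral_le_or_eventually_polynomial_real {h : ℝ → ℝ} (hh : AnalyticAt ℝ h 0)
    (M H : ℕ) :
    (∃ T₀ : ℕ, ∀ T ≥ T₀, ∀ s ⊆ Finset.Icc T (T + H),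
      (∀ n ∈ s, ∃ z : ℤ, (n : ℝ) ^ M * h (n : ℝ)⁻¹ = z) → s.card ≤ M + 1) ∨
    ∃ p : ℚ[X], ∀ᶠ t : ℝ in atTop, t ^ M * h t⁻¹ = p.aeval t := by
  classical
  obtain ⟨δ, hδ, hball⟩ := hh.exists_ball_analyticOnNhd
  have hinv : Tendsto (fun t : ℝ => t⁻¹) atTop (𝓝[≠] 0) :=
    tendsto_inv_atTop_nhdsGT_zero.mono_right (nhdsWithin_mono _ fun x hx => ne_of_gt hx)
  set g : ℕ → ℝ → ℝ := fun j t => t ^ ((M : ℤ) - j) * tailSeq h M j t⁻¹ with hg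
  have hg0 : ∀ t, g 0 t = t ^ M * h t⁻¹ := fun t => by simp [hg, tailSeq]
  obtain ⟨a, ha0, ha⟩ : ∃ a : ℝ, 0 < a ∧ ∀ j t, a < t → HasDerivAt (g j) (g (j + 1) t) t := by
    refine ⟨δ⁻¹, by positivity, fun j t ht => ?_⟩
    have ht0 : 0 < t := lt_trans (by positivity) ht
    refine hasDerivAt_zpow_mul_tailSeq M j ht0.ne' (tailSeq_analyticOnNhd M hball j _ ?_)
    rw [Metric.mem_ball, dist_zero_right, Real.norm_of_nonneg (by positivity)]
    exact inv_lt_of_inv_lt₀ hδ ht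
  have han : AnalyticAt ℝ (tailSeq h M (M + 1)) 0 :=
    tailSeq_analyticOnNhd M hball (M + 1) 0 (Metric.mem_ball_self hδ)
  rcases han.eventually_eq_zero_or_eventually_ne_zero with hzero | hne
  · have hz : ∀ᶠ t : ℝ in atTop, g (M + 1) t = 0 := by
      filter_upwards [(hinv.mono_right nhdsWithin_le_nhds).eventually hzero] with t ht
      simp [hg, ht]
    obtain ⟨b, hb⟩ := eventually_atTop.mp hz
    set c := max a b
    have hc : ∀ j t, c < t → HasDerivAt (g j) (g (j + 1) t) t := fun j t ht =>
      ha j t ((le_max_left _ _).trans_lt ht)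
    by_cases hex : ∃ s : Finset ℕ, s.card = M + 1 ∧ (∀ n ∈ s, c < n) ∧
        ∀ n ∈ s, ∃ z : ℤ, (n : ℝ) ^ M * h (n : ℝ)⁻¹ = z
    · right
      obtain ⟨s, hcard, hcs, hint⟩ := hex
      choose! z hz using hint
      set p : ℚ[X] := Lagrange.interpolate s (fun n => (n : ℚ)) (fun n => (z n : ℚ)) with hp
      have hinjQ : Set.InjOn (fun n : ℕ => (n : ℚ)) s := Nat.cast_injective.injOn
      have hpdeg : (p.map (algebraMap ℚ ℝ)).degree < (M + 1 : ℕ) := by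
        rw [Polynomial.degree_map, ← hcard]
        exact Lagrange.degree_interpolate_lt (r := fun n => (z n : ℚ)) hinjQ
      have hpev : ∀ n ∈ s, (p.map (algebraMap ℚ ℝ)).eval (n : ℝ) = g 0 n := by
        intro n hn
        have := Lagrange.eval_interpolate_at_node (r := fun n => (z n : ℚ)) hinjQ hn
        have e : (n : ℝ) = algebraMap ℚ ℝ (n : ℚ) := by simp
        rw [hg0, hz n hn, e, Polynomial.eval_map_apply, hp, this]
        simp
      refine ⟨p, ?_⟩
      filter_upwards [eventually_gt_atTop c] with t ht
      rw [← hg0, ← Polynomial.eval_map_algebraMap]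
      set S := s.image (Nat.cast : ℕ → ℝ) with hS
      have hScard : S.card = M + 1 := by
        rw [hS, Finset.card_image_of_injective _ Nat.cast_injective, hcard]
      by_cases htS : t ∈ S
      · obtain ⟨n, hn, rfl⟩ := Finset.mem_image.mp htS
        exact (hpev n hn).symm
      have hinj : Set.InjOn (id : ℝ → ℝ) (insert t S : Finset ℝ) := Function.injective_id.injOn
      have hcI : (insert t S).card = M + 1 + 1 := by rw [Finset.card_insert_of_notMem htS, hScard]
      have hgt : ∀ x ∈ insert t S, c < x := by
        intro x hx
        rcases Finset.mem_insert.mp hx with rfl | hx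
        · exact ht
        · obtain ⟨n, hn, rfl⟩ := Finset.mem_image.mp hx
          exact hcs n hn
      obtain ⟨ξ, hξ, heq⟩ := exists_deriv_seq_eq_coeff (M + 1) g hc (insert t S) hgt hcI
      rw [hb ξ ((le_max_right _ _).trans hξ.le)] at heq
      have hcoef : (Lagrange.interpolate (insert t S) id (g 0)).coeff (M + 1) = 0 := by
        have : ((M + 1).factorial : ℝ) ≠ 0 := by positivity
        simpa [this] using heq.symm
      set q := Lagrange.interpolate (insert t S) id (g 0) with hq
      have hqev : ∀ x ∈ insert t S, q.eval x = g 0 x := fun x hx =>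
        Lagrange.eval_interpolate_at_node (r := g 0) hinj hx
      have hqdeg : q.degree < (M + 1 : ℕ) := by
        have h1 := Lagrange.degree_interpolate_lt (r := g 0) hinj
        rw [hcI, ← hq] at h1
        rw [Polynomial.degree_lt_iff_coeff_zero] at h1 ⊢
        intro m hm
        rcases hm.eq_or_lt with rfl | hm
        · exact hcoef
        · exact h1 m hm
      have : p.map (algebraMap ℚ ℝ) = q := by
        refine Polynomial.eq_of_degrees_lt_of_eval_finset_eq S (by rwa [hScard]) (by rwa [hScard]) ?_
        intro x hx
        rw [hqev x (Finset.mem_insert_of_mem hx)]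
        obtain ⟨n, hn, rfl⟩ := Finset.mem_image.mp hx
        exact hpev n hn
      rw [this, hqev t (Finset.mem_insert_self _ _)]
    · left
      obtain ⟨T₀, hT₀⟩ := exists_nat_gt c
      refine ⟨T₀, fun T hT s hs hint => ?_⟩
      by_contra! hlt
      obtain ⟨s', hs', hcard'⟩ := Finset.exists_subset_card_eq hlt.le
      refine hex ⟨s', hcard', fun n hn => ?_, fun n hn => hint n (hs' hn)⟩
      have := (Finset.mem_Icc.mp (hs (hs' hn))).1
      exact hT₀.trans_le (by exact_mod_cast hT.trans this)
  · left
    set W : ℝ := (H.factorial : ℝ) ^ (M + 1) with hW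
    have hgne : ∀ᶠ t : ℝ in atTop, g (M + 1) t ≠ 0 := by
      filter_upwards [hinv.eventually hne, eventually_gt_atTop 0] with t ht ht0
      exact mul_ne_zero (zpow_ne_zero _ ht0.ne') ht
    have hgt : Tendsto (g (M + 1)) atTop (𝓝 0) := by
      have h1 : Tendsto (fun t : ℝ => tailSeq h M (M + 1) t⁻¹) atTop
          (𝓝 (tailSeq h M (M + 1) 0)) :=
        han.continuousAt.tendsto.comp (hinv.mono_right nhdsWithin_le_nhds)
      have h2 := tendsto_inv_atTop_zero.mul h1
      rw [zero_mul] at h2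
      refine h2.congr fun t => ?_
      simp only [hg]
      congr 1
      rw [← zpow_neg_one]; congr 1; push_cast; ring
    have hsmall : ∀ᶠ t : ℝ in atTop, |W * g (M + 1) t| < 1 := by
      have h1 := (hgt.const_mul W).abs
      rw [mul_zero, abs_zero] at h1
      exact h1.eventually (gt_mem_nhds one_pos)
    obtain ⟨b, hb⟩ := eventually_atTop.mp (hgne.and hsmall)
    set c := max a b
    obtain ⟨T₀, hT₀⟩ := exists_nat_gt c
    refine ⟨T₀, fun T hT s hs hint => ?_⟩
    by_contra! hlt
    obtain ⟨s', hs', hcard'⟩ := Finset.exists_subset_card_eq (show M + 1 + 1 ≤ s.card from hlt)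
    have hgc : ∀ x ∈ s'.image (Nat.cast : ℕ → ℝ), c < x := by
      intro x hx
      obtain ⟨n, hn, rfl⟩ := Finset.mem_image.mp hx
      have := (Finset.mem_Icc.mp (hs (hs' hn))).1
      exact hT₀.trans_le (by exact_mod_cast hT.trans this)
    obtain ⟨ξ, hξ, heq⟩ := exists_deriv_seq_eq_coeff (M + 1) g
      (fun j t ht => ha j t ((le_max_left _ _).trans_lt ht)) _ hgc
      (by rw [Finset.card_image_of_injective _ Nat.cast_injective, hcard'])
    obtain ⟨z, hz⟩ := exists_int_eq_factorial_pow_mul_coeff_interpolate (M + 1) H T s'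
      (hs'.trans hs) hcard' (g 0) (fun n hn => by rw [hg0]; exact hint n (hs' hn))
    obtain ⟨hξne, hξlt⟩ := hb ξ ((le_max_right _ _).trans hξ.le)
    have hW0 : W ≠ 0 := by positivity
    have e : W * g (M + 1) ξ = (((M + 1).factorial * z : ℤ) : ℝ) := by
      rw [heq]; push_cast; rw [← hz]; ring
    have hne0 : W * g (M + 1) ξ ≠ 0 := mul_ne_zero hW0 hξne
    rw [e] at hξlt hne0
    have h1 : |((M + 1).factorial * z : ℤ)| < 1 := by exact_mod_cast hξlt
    exact hne0 (by exact_mod_cast Int.abs_lt_one_iff.mp h1)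

end Sparse

section Complex

/-- If `h` is complex analytic at `0` and `n ^ M * h (1 / n)` takes integral values at many
integers `n`, then it is a rational polynomial near infinity. -/
theorem card_integral_le_or_eventually_polynomial {h : ℂ → ℂ} (hh : AnalyticAt ℂ h 0)
    (M H : ℕ) :
    (∃ T₀ : ℕ, ∀ T ≥ T₀, ∀ s ⊆ Finset.Icc T (T + H),
      (∀ n ∈ s, ∃ z : ℤ, (n : ℂ) ^ M * h (n : ℂ)⁻¹ = z) → s.card ≤ M + 1) ∨
    ∃ p : ℚ[X], ∀ᶠ n : ℕ in atTop, (n : ℂ) ^ M * h (n : ℂ)⁻¹ = p.aeval (n : ℂ) := by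
  have hh' : AnalyticAt ℂ h ((0 : ℝ) : ℂ) := by simpa using hh
  have key : ∀ n : ℕ, (n : ℂ) ^ M * h (n : ℂ)⁻¹ =
      ((n : ℝ) ^ M * (h (((n : ℝ)⁻¹ : ℝ) : ℂ)).re : ℝ) +
        ((n : ℝ) ^ M * (h (((n : ℝ)⁻¹ : ℝ) : ℂ)).im : ℝ) * Complex.I := by
    intro n
    have e : (n : ℂ)⁻¹ = (((n : ℝ)⁻¹ : ℝ) : ℂ) := by push_cast; rfl
    rw [e]
    conv_lhs => rw [← Complex.re_add_im (h _)]
    push_cast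
    ring
  have hre : ∀ (n : ℕ) (z : ℤ), (n : ℂ) ^ M * h (n : ℂ)⁻¹ = z →
      (n : ℝ) ^ M * (h (((n : ℝ)⁻¹ : ℝ) : ℂ)).re = z ∧
      (n : ℝ) ^ M * (h (((n : ℝ)⁻¹ : ℝ) : ℂ)).im = 0 := by
    intro n z hz
    rw [key] at hz
    generalize (n : ℝ) ^ M * (h (((n : ℝ)⁻¹ : ℝ) : ℂ)).re = A at hz ⊢
    generalize (n : ℝ) ^ M * (h (((n : ℝ)⁻¹ : ℝ) : ℂ)).im = B at hz ⊢
    have h1 := congrArg Complex.re hz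
    have h2 := congrArg Complex.im hz
    exact ⟨by simpa using h1, by simpa using h2⟩
  rcases card_integral_le_or_eventually_polynomial_real hh'.re_ofReal M H with
    ⟨T₀, h₀⟩ | ⟨p, hp⟩
  · left
    refine ⟨T₀, fun T hT s hs hint => h₀ T hT s hs fun n hn => ?_⟩
    obtain ⟨z, hz⟩ := hint n hn
    exact ⟨z, (hre n z hz).1⟩
  rcases card_integral_le_or_eventually_polynomial_real hh'.im_ofReal M H with
    ⟨T₀, h₀⟩ | ⟨q, hq⟩
  · left
    refine ⟨T₀, fun T hT s hs hint => h₀ T hT s hs fun n hn => ?_⟩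
    obtain ⟨z, hz⟩ := hint n hn
    exact ⟨0, by simpa using (hre n z hz).2⟩
  have hp' := tendsto_natCast_atTop_atTop.eventually hp
  have hq' := tendsto_natCast_atTop_atTop.eventually hq
  by_cases hq0 : q = 0
  · right
    refine ⟨p, ?_⟩
    filter_upwards [hp', hq'] with n h1 h2
    rw [key, h1, h2, hq0]
    have : p.aeval (n : ℂ) = ((p.aeval (n : ℝ) : ℝ) : ℂ) := by
      rw [show (n : ℂ) = algebraMap ℝ ℂ (n : ℝ) by simp, Polynomial.aeval_algebraMap_apply]
      rfl
    rw [this]; simp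
  · left
    have hne : ∀ᶠ n : ℕ in atTop, q.aeval (n : ℝ) ≠ 0 := by
      have hfin : {n : ℕ | q.aeval (n : ℝ) = 0}.Finite := by
        refine Set.Finite.of_finite_image (f := (Nat.cast : ℕ → ℝ))
          ((q.rootSet_finite ℝ).subset ?_) Nat.cast_injective.injOn
        rintro _ ⟨n, hn, rfl⟩
        exact (Polynomial.mem_rootSet_of_ne hq0).mpr hn
      rw [← Nat.cofinite_eq_atTop]
      exact hfin.eventually_cofinite_notMem
    obtain ⟨T₀, h₀⟩ := eventually_atTop.mp (hq'.and hne)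
    refine ⟨T₀, fun T hT s hs hint => ?_⟩
    have : s = ∅ := by
      by_contra hs0
      obtain ⟨n, hn⟩ := Finset.nonempty_iff_ne_empty.mpr hs0
      obtain ⟨z, hz⟩ := hint n hn
      obtain ⟨h1, h2⟩ := h₀ n (hT.trans (Finset.mem_Icc.mp (hs hn)).1)
      exact h2 (h1 ▸ (hre n z hz).2)
    simp [this]

end Complex

section AnalyticRoots

open scoped ContDiff

theorem contDiff_eval_map_evalRingHom (P : ℂ[X][X]) (a : ℂ) {n : WithTop ℕ∞} :
    ContDiff ℂ n fun q : ℂ × ℂ => (P.map (evalRingHom (a + q.1))).eval q.2 := by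
  simp only [Polynomial.eval_map, Polynomial.eval₂_eq_sum_range, coe_evalRingHom]
  refine ContDiff.sum fun i _ => ContDiff.mul ?_ (contDiff_snd.pow i)
  simp only [Polynomial.eval_eq_sum_range]
  exact ContDiff.sum fun j _ => contDiff_const.mul ((contDiff_const.add contDiff_fst).pow j)

/-- A simple root of a specialization of a bivariate polynomial extends to an analytic branch. -/
theorem exists_analytic_root (P : ℂ[X][X]) (a z : ℂ)
    (hz : (P.map (evalRingHom a)).eval z = 0)
    (hz' : (derivative (P.map (evalRingHom a))).eval z ≠ 0) :
    ∃ y : ℂ → ℂ, AnalyticAt ℂ y 0 ∧ y 0 = z ∧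
      ∀ᶠ s in 𝓝 0, (P.map (evalRingHom (a + s))).eval (y s) = 0 := by
  set G : ℂ × ℂ → ℂ := fun q => (P.map (evalRingHom (a + q.1))).eval q.2 with hG
  have hGc : ContDiff ℂ ω G := contDiff_eval_map_evalRingHom P a
  set G' := fderiv ℂ G (0, z) with hG'
  have hGd : HasFDerivAt G G' (0, z) :=
    (hGc.differentiable (by simp) (0, z)).hasFDerivAt
  have hG01 : G' (0, 1) ≠ 0 := by
    have h1 : HasDerivAt (fun w : ℂ => ((0 : ℂ), w)) ((0 : ℂ), (1 : ℂ)) z :=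
      (hasDerivAt_const z (0 : ℂ)).prodMk (hasDerivAt_id z)
    have h2 := hGd.comp_hasDerivAt z h1
    have h3 : HasDerivAt (G ∘ fun w : ℂ => ((0 : ℂ), w))
        ((derivative (P.map (evalRingHom a))).eval z) z := by
      have : (G ∘ fun w : ℂ => ((0 : ℂ), w)) = fun w => (P.map (evalRingHom a)).eval w := by
        ext w; simp [hG]
      rw [this]
      exact Polynomial.hasDerivAt _ z
    rw [h2.unique h3]
    exact hz'
  set L : ℂ × ℂ →L[ℂ] ℂ × ℂ := (ContinuousLinearMap.fst ℂ ℂ ℂ).prod G' with hL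
  have hinj : Function.Injective L := by
    rw [injective_iff_map_eq_zero]
    rintro ⟨u, v⟩ huv
    have hu : u = 0 := congrArg Prod.fst huv
    have hv : G' (u, v) = 0 := congrArg Prod.snd huv
    have e : ((0 : ℂ), v) = v • ((0 : ℂ), (1 : ℂ)) := by simp
    rw [hu, e, map_smul, smul_eq_mul] at hv
    rw [hu, (mul_eq_zero.mp hv).resolve_right hG01]
    rfl
  set E : (ℂ × ℂ) ≃L[ℂ] ℂ × ℂ :=
    (LinearEquiv.ofInjectiveEndo (L : ℂ × ℂ →ₗ[ℂ] ℂ × ℂ) hinj).toContinuousLinearEquiv with hE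
  set Φ : ℂ × ℂ → ℂ × ℂ := fun q => (q.1, G q) with hΦ
  have hΦc : ContDiffAt ℂ ω Φ (0, z) := (contDiff_fst.prodMk hGc).contDiffAt
  have hΦd : HasFDerivAt Φ (E : ℂ × ℂ →L[ℂ] ℂ × ℂ) (0, z) :=
    HasFDerivAt.prodMk hasFDerivAt_fst hGd
  have hΦ0 : Φ (0, z) = (0, 0) := by simp [hΦ, hG, hz]
  have hω : (ω : WithTop ℕ∞) ≠ 0 := by simp
  set Ψ := hΦc.localInverse hΦd hω with hΨ
  have hΨc : ContDiffAt ℂ ω Ψ (0, 0) := hΦ0 ▸ hΦc.to_localInverse hΦd hω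
  have hΨ0 : Ψ (0, 0) = (0, z) := by
    have := hΦc.localInverse_apply_image hΦd hω
    rwa [hΦ0] at this
  have hright : ∀ᶠ q in 𝓝 ((0 : ℂ), (0 : ℂ)), Φ (Ψ q) = q := by
    have := (hΦc.hasStrictFDerivAt' hΦd hω).eventually_right_inverse
    rwa [hΦ0] at this
  have hinc : ContDiffAt ℂ ω (fun s : ℂ => (s, (0 : ℂ))) 0 := contDiffAt_id.prodMk contDiffAt_const
  refine ⟨fun s => (Ψ (s, 0)).2, ?_, by simp [hΨ0], ?_⟩
  · have : ContDiffAt ℂ ω (fun s : ℂ => (Ψ (s, 0)).2) 0 :=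
      contDiffAt_snd.comp (0 : ℂ) (ContDiffAt.comp (0 : ℂ) hΨc hinc)
    exact this.analyticAt
  · have ht : Tendsto (fun s : ℂ => (s, (0 : ℂ))) (𝓝 0) (𝓝 (0, 0)) := hinc.continuousAt
    filter_upwards [ht.eventually hright] with s hs
    have h1 : (Ψ (s, 0)).1 = s := congrArg Prod.fst hs
    have h2 : G (Ψ (s, 0)) = 0 := congrArg Prod.snd hs
    simpa [hG, h1] using h2

/-- Near a point with separable specialization, a monic bivariate polynomial splits into linear
factors with analytic roots. -/
theorem exists_analytic_roots (P : ℂ[X][X]) (hP : P.Monic) (a : ℂ)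
    (hsep : (P.map (evalRingHom a)).Separable) :
    ∃ (R : Finset ℂ) (y : ℂ → ℂ → ℂ), R.card = P.natDegree ∧ (∀ z ∈ R, AnalyticAt ℂ (y z) 0) ∧
      ∀ᶠ s in 𝓝 0, P.map (evalRingHom (a + s)) = ∏ z ∈ R, (X - C (y z s)) := by
  classical
  set Pa := P.map (evalRingHom a) with hPa
  have hPa0 : Pa ≠ 0 := (hP.map _).ne_zero
  set R := Pa.roots.toFinset with hR
  have hcard : R.card = P.natDegree := by
    rw [hR, Multiset.toFinset_card_of_nodup (nodup_roots hsep),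
      ← (IsAlgClosed.splits Pa).natDegree_eq_card_roots, hPa, hP.natDegree_map]
  have hy : ∀ z ∈ R, ∃ y : ℂ → ℂ, AnalyticAt ℂ y 0 ∧ y 0 = z ∧
      ∀ᶠ s in 𝓝 0, (P.map (evalRingHom (a + s))).eval (y s) = 0 := by
    intro z hz
    rw [hR, Multiset.mem_toFinset, mem_roots hPa0] at hz
    refine exists_analytic_root P a z hz ?_
    have := hsep.eval₂_derivative_ne_zero (RingHom.id ℂ) (x := z) (by simpa using hz)
    simpa only [eval₂_id] using this
  choose! y hya hy0 hyr using hy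
  refine ⟨R, y, hcard, hya, ?_⟩
  have hdist : ∀ᶠ s in 𝓝 (0 : ℂ), ∀ z ∈ R, ∀ w ∈ R, z ≠ w → y z s ≠ y w s := by
    rw [Finset.eventually_all]
    intro z hz
    rw [Finset.eventually_all]
    intro w hw
    by_cases hzw : z = w
    · simp [hzw]
    have := ((hya z hz).continuousAt.tendsto.sub (hya w hw).continuousAt.tendsto).eventually
      (isOpen_ne.mem_nhds (show y z 0 - y w 0 ≠ 0 by rwa [hy0 z hz, hy0 w hw, sub_ne_zero]))
    filter_upwards [this] with s hs _ using sub_ne_zero.mp hs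
  have hroots : ∀ᶠ s in 𝓝 (0 : ℂ), ∀ z ∈ R, (P.map (evalRingHom (a + s))).eval (y z s) = 0 := by
    rw [Finset.eventually_all]
    exact hyr
  filter_upwards [hdist, hroots] with s hd hr
  refine Polynomial.eq_of_monic_of_dvd_of_natDegree_le
    (monic_prod_of_monic _ (fun z => X - C (y z s)) fun z _ => monic_X_sub_C _) (hP.map _) ?_ ?_
  · refine Finset.prod_dvd_of_coprime ?_ ?_
    · intro z hz w hw hzw
      exact isCoprime_X_sub_C_of_isUnit_sub (sub_ne_zero.mpr (hd z hz w hw hzw)).isUnit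
    · intro z hz
      exact dvd_iff_isRoot.mpr (hr z hz)
  · rw [hP.natDegree_map, natDegree_prod_of_monic _ (fun z => X - C (y z s)) fun z _ => monic_X_sub_C _]
    simp [hcard]

end AnalyticRoots

section Specialization

/-- An irreducible polynomial over `k[X]` and a nonzero one of smaller degree are coprime up to
a nonzero element of `k[X]`. -/
theorem exists_bezout_of_irreducible {k : Type*} [Field k] {F G : k[X][X]} (hF : F.Monic)
    (hirr : Irreducible F) (hG : G ≠ 0) (hdeg : G.natDegree < F.natDegree) :
    ∃ (U V : k[X][X]) (ρ : k[X]), ρ ≠ 0 ∧ U * F + V * G = C ρ := by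
  set K := FractionRing k[X]
  set φ := algebraMap k[X] K
  have hφ : Function.Injective φ := IsFractionRing.injective _ _
  have hFK : Irreducible (F.map φ) := hF.irreducible_iff_irreducible_map_fraction_map.mp hirr
  have hcop : IsCoprime (F.map φ) (G.map φ) := by
    refine hFK.coprime_iff_not_dvd.mpr fun hdvd => ?_
    have h0 : G.map φ ≠ 0 := (Polynomial.map_ne_zero_iff hφ).mpr hG
    have := natDegree_le_of_dvd hdvd h0
    rw [natDegree_map_eq_of_injective hφ, natDegree_map_eq_of_injective hφ] at this
    omega
  obtain ⟨u, v, huv⟩ := hcop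
  obtain ⟨b, hbM, hb⟩ := IsLocalization.integerNormalization_spec (nonZeroDivisors k[X]) u
  obtain ⟨c, hcM, hc⟩ := IsLocalization.integerNormalization_spec (nonZeroDivisors k[X]) v
  set u' := IsLocalization.integerNormalization (nonZeroDivisors k[X]) u
  set v' := IsLocalization.integerNormalization (nonZeroDivisors k[X]) v
  refine ⟨C c * u', C b * v', b * c,
    mul_ne_zero (nonZeroDivisors.ne_zero hbM) (nonZeroDivisors.ne_zero hcM), ?_⟩
  apply Polynomial.map_injective φ hφ
  have hb' : u'.map φ = C (φ b) * u := by
    rw [hb, Algebra.smul_def]; rfl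
  have hc' : v'.map φ = C (φ c) * v := by
    rw [hc, Algebra.smul_def]; rfl
  simp only [Polynomial.map_add, Polynomial.map_mul, Polynomial.map_C, hb', hc', map_mul]
  linear_combination (C (φ b) * C (φ c)) * huv

theorem exists_separable_specialization {k : Type*} [Field k] [CharZero k] {F : k[X][X]}
    (hF : F.Monic) (hirr : Irreducible F) : ∃ a : k, (F.map (evalRingHom a)).Separable := by
  have hn : F.natDegree ≠ 0 := fun h0 =>
    hirr.not_isUnit (by rw [hF.natDegree_eq_zero.mp h0]; exact isUnit_one)
  have hd : derivative F ≠ 0 := fun h0 => hn (Polynomial.derivative_eq_zero.mp h0)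
  obtain ⟨U, V, ρ, hρ, h⟩ := exists_bezout_of_irreducible hF hirr hd
    (natDegree_derivative_lt hn)
  obtain ⟨a, ha⟩ : ∃ a, ρ.eval a ≠ 0 := by
    by_contra! hall
    exact hρ (Polynomial.funext (by simpa using hall))
  refine ⟨a, C (ρ.eval a)⁻¹ * U.map (evalRingHom a), C (ρ.eval a)⁻¹ * V.map (evalRingHom a), ?_⟩
  have h' := congrArg (Polynomial.map (evalRingHom a)) h
  simp only [Polynomial.map_add, Polynomial.map_mul, Polynomial.map_C, coe_evalRingHom,
    ← derivative_map] at h'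
  rw [mul_assoc, mul_assoc, ← mul_add, h', ← C_mul, inv_mul_cancel₀ ha, C_1]

/-- The denominators of the values of a rational polynomial at `a + 1 / t` divide `D * t ^ e`. -/
theorem exists_int_eq_mul_eval (a : ℚ) (c : ℚ[X]) :
    ∃ D e : ℕ, 0 < D ∧ ∀ t : ℕ, 0 < t → ∃ m : ℤ, (D * t ^ e : ℚ) * c.eval (a + (t : ℚ)⁻¹) = m := by
  induction c using Polynomial.induction_on with
  | C q =>
    refine ⟨q.den, 0, q.den_pos, fun t _ => ⟨q.num, ?_⟩⟩
    simp [mul_comm, Rat.mul_den_eq_num]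
  | add p q hp hq =>
    obtain ⟨D, e, hD, h⟩ := hp
    obtain ⟨D', e', hD', h'⟩ := hq
    refine ⟨D * D', e + e', Nat.mul_pos hD hD', fun t ht => ?_⟩
    obtain ⟨m, hm⟩ := h t ht
    obtain ⟨m', hm'⟩ := h' t ht
    refine ⟨D' * t ^ e' * m + D * t ^ e * m', ?_⟩
    push_cast
    rw [← hm, ← hm', eval_add]
    ring
  | monomial n q h =>
    obtain ⟨D, e, hD, h⟩ := h
    refine ⟨D * a.den, e + 1, Nat.mul_pos hD a.den_pos, fun t ht => ?_⟩
    obtain ⟨m, hm⟩ := h t ht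
    refine ⟨m * (a.num * t + a.den), ?_⟩
    have hden : (a.den : ℚ) * a = a.num := by rw [mul_comm, Rat.mul_den_eq_num]
    have ht' : (t : ℚ) ≠ 0 := by positivity
    have hev : ∀ x : ℚ, eval x (C q * X ^ (n + 1)) = eval x (C q * X ^ n) * x := fun x => by
      simp [pow_succ, mul_assoc]
    push_cast
    rw [← hm, ← hden, hev]
    generalize eval _ (C q * X ^ n) = v
    field_simp
    ring

theorem exists_int_eq_mul_coeff_map_eval (a : ℚ) (F : ℚ[X][X]) :
    ∃ D e : ℕ, 0 < D ∧ ∀ t : ℕ, 0 < t → ∀ i, ∃ m : ℤ,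
      (D * t ^ e : ℚ) * (F.map (evalRingHom (a + (t : ℚ)⁻¹))).coeff i = m := by
  induction F using Polynomial.induction_on' with
  | add p q hp hq =>
    obtain ⟨D, e, hD, h⟩ := hp
    obtain ⟨D', e', hD', h'⟩ := hq
    refine ⟨D * D', e + e', Nat.mul_pos hD hD', fun t ht i => ?_⟩
    obtain ⟨m, hm⟩ := h t ht i
    obtain ⟨m', hm'⟩ := h' t ht i
    refine ⟨D' * t ^ e' * m + D * t ^ e * m', ?_⟩
    push_cast
    rw [← hm, ← hm', Polynomial.map_add, coeff_add]
    ring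
  | monomial n c =>
    obtain ⟨D, e, hD, h⟩ := exists_int_eq_mul_eval a c
    refine ⟨D, e, hD, fun t ht i => ?_⟩
    rw [map_monomial, coeff_monomial]
    split_ifs with hi
    · exact h t ht
    · exact ⟨0, by simp⟩

theorem exists_subset_prod_eq_of_dvd {k ι : Type*} [Field k] (R : Finset ι) (f : ι → k) {g : k[X]}
    (hg : g.Monic) (hdvd : g ∣ ∏ z ∈ R, (X - C (f z))) :
    ∃ S ⊆ R, g = ∏ z ∈ S, (X - C (f z)) := by
  classical
  induction R using Finset.induction_on generalizing g with
  | empty =>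
    refine ⟨∅, subset_rfl, ?_⟩
    rw [Finset.prod_empty] at hdvd ⊢
    exact hg.eq_one_of_isUnit (isUnit_of_dvd_one hdvd)
  | insert z R hz ih =>
    rw [Finset.prod_insert hz] at hdvd
    by_cases hzg : (X - C (f z)) ∣ g
    · obtain ⟨q, rfl⟩ := hzg
      have hq : q.Monic := (monic_X_sub_C (f z)).of_mul_monic_left hg
      obtain ⟨S, hS, rfl⟩ := ih hq ((mul_dvd_mul_iff_left (X_sub_C_ne_zero (f z))).mp hdvd)
      refine ⟨insert z S, Finset.insert_subset_insert _ hS, ?_⟩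
      rw [Finset.prod_insert fun h => hz (hS h)]
    · have hc : IsCoprime (X - C (f z)) g :=
        (irreducible_X_sub_C (f z)).coprime_iff_not_dvd.mpr hzg
      obtain ⟨S, hS, rfl⟩ := ih hg (hc.symm.dvd_of_dvd_mul_left hdvd)
      exact ⟨S, hS.trans (Finset.subset_insert _ _), rfl⟩

/-- If the product of the `X - r z` over `R` becomes integral after multiplication by `w`, then
rational subproducts become integral after multiplication by `w ^ #R`. -/
theorem exists_int_eq_pow_mul_coeff_prod {ι : Type*} (w : ℕ) (f : ℚ[X]) (hf : f.Monic)
    (hint : ∀ i, ∃ m : ℤ, (w : ℚ) * f.coeff i = m) (R S : Finset ι) (hS : S ⊆ R) (r : ι → ℂ)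
    (hR : f.map (algebraMap ℚ ℂ) = ∏ z ∈ R, (X - C (r z))) (g : ℚ[X])
    (hg : g.map (algebraMap ℚ ℂ) = ∏ z ∈ S, (X - C (r z))) (j : ℕ) :
    ∃ m : ℤ, (w : ℂ) ^ R.card * (∏ z ∈ S, (X - C (r z))).coeff j = m := by
  obtain ⟨Q, hQ⟩ : ∃ Q : ℤ[X], Q.map (Int.castRingHom ℚ) = C (w : ℚ) * f := by
    have : C (w : ℚ) * f ∈ Polynomial.lifts (Int.castRingHom ℚ) := by
      rw [Polynomial.lifts_iff_coeff_lifts]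
      intro i
      obtain ⟨m, hm⟩ := hint i
      exact ⟨m, by rw [coeff_C_mul, hm]; rfl⟩
    exact (Polynomial.mem_lifts _).mp this
  have hlead : Q.leadingCoeff = w := by
    have h1 : (Q.map (Int.castRingHom ℚ)).leadingCoeff = (Int.castRingHom ℚ) Q.leadingCoeff :=
      leadingCoeff_map_of_injective Int.cast_injective _
    rw [hQ, leadingCoeff_mul, hf.leadingCoeff, leadingCoeff_C, mul_one] at h1
    have h2 : ((w : ℤ) : ℚ) = (Q.leadingCoeff : ℚ) := by simpa using h1
    exact_mod_cast h2.symm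
  have hroot : ∀ z ∈ R, IsIntegral ℤ ((w : ℂ) * r z) := by
    intro z hz
    have h0 : aeval (r z) Q = 0 := by
      have e : aeval (r z) Q = (f.map (algebraMap ℚ ℂ)).eval (r z) * w := by
        have : aeval (r z) Q = aeval (r z) (Q.map (Int.castRingHom ℚ)) := by
          rw [show Int.castRingHom ℚ = algebraMap ℤ ℚ from rfl, aeval_map_algebraMap]
        rw [this, hQ, map_mul, aeval_C, eval_map_algebraMap, mul_comm]
        simp
      rw [e, hR, eval_prod, Finset.prod_eq_zero hz (by simp), zero_mul]
    have := isIntegral_leadingCoeff_smul Q (r z) h0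
    rw [hlead] at this
    simpa using this
  have hlift : C ((w : ℂ) ^ R.card) * ∏ z ∈ S, (X - C (r z)) ∈
      Polynomial.lifts (integralClosure ℤ ℂ).subtype := by
    have e : C ((w : ℂ) ^ R.card) * ∏ z ∈ S, (X - C (r z)) =
        C (w : ℂ) ^ (R.card - S.card) * ∏ z ∈ S, (C (w : ℂ) * X - C ((w : ℂ) * r z)) := by
      have : ∏ z ∈ S, (C (w : ℂ) * X - C ((w : ℂ) * r z)) =
          C (w : ℂ) ^ S.card * ∏ z ∈ S, (X - C (r z)) := by
        rw [← Finset.prod_const, ← Finset.prod_mul_distrib]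
        exact Finset.prod_congr rfl fun z _ => by rw [C_mul]; ring
      rw [this, ← mul_assoc, ← pow_add, Nat.sub_add_cancel (Finset.card_le_card hS), C_pow]
    have hCl : ∀ x : ℂ, IsIntegral ℤ x →
        C x ∈ Polynomial.lifts (integralClosure ℤ ℂ).subtype := fun x hx =>
      (Polynomial.mem_lifts _).mpr ⟨C ⟨x, hx⟩, by rw [Polynomial.map_C]; rfl⟩
    have hwl : C (w : ℂ) ∈ Polynomial.lifts (integralClosure ℤ ℂ).subtype := by
      refine hCl _ ?_
      simpa using (isIntegral_algebraMap (R := ℤ) (A := ℂ) (x := (w : ℤ)))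
    rw [e]
    refine mul_mem (pow_mem hwl _) (prod_mem fun z hz => ?_)
    rw [sub_eq_add_neg, ← C_neg]
    refine add_mem (mul_mem hwl ?_) (hCl _ (hroot z (hS hz)).neg)
    exact (Polynomial.mem_lifts _).mpr ⟨X, by simp⟩
  have hcoef : IsIntegral ℤ ((w : ℂ) ^ R.card * (∏ z ∈ S, (X - C (r z))).coeff j) := by
    obtain ⟨x, hx⟩ := (Polynomial.lifts_iff_coeff_lifts _).mp hlift j
    rw [coeff_C_mul] at hx
    rw [← hx]
    exact x.2
  have hrat : (w : ℂ) ^ R.card * (∏ z ∈ S, (X - C (r z))).coeff j =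
      algebraMap ℚ ℂ ((w : ℚ) ^ R.card * g.coeff j) := by
    rw [← hg, coeff_map]; simp
  rw [hrat] at hcoef ⊢
  rw [isIntegral_algebraMap_iff (algebraMap ℚ ℂ).injective] at hcoef
  obtain ⟨m, hm⟩ := IsIntegrallyClosed.isIntegral_iff.mp hcoef
  exact ⟨m, by rw [← hm]; simp⟩

theorem analyticAt_coeff_prod {ι : Type*} (S : Finset ι) (y : ι → ℂ → ℂ)
    (hy : ∀ z ∈ S, AnalyticAt ℂ (y z) 0) (j : ℕ) :
    AnalyticAt ℂ (fun s => (∏ z ∈ S, (X - C (y z s))).coeff j) 0 := by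
  classical
  induction S using Finset.induction_on generalizing j with
  | empty => simpa using analyticAt_const
  | insert z S hz ih =>
    have ih' := ih fun x hx => hy x (Finset.mem_insert_of_mem hx)
    have hyz := hy z (Finset.mem_insert_self _ _)
    simp only [Finset.prod_insert hz, sub_mul, coeff_sub, coeff_C_mul]
    refine AnalyticAt.sub ?_ (hyz.mul (ih' j))
    cases j with
    | zero => simpa using analyticAt_const
    | succ j => simpa only [coeff_X_mul] using ih' j

end Specialization

section HilbertIrreducibility

/-- Evaluation of rational polynomials at the complex number `a + 1 / t`. -/
def evalNear (a : ℚ) (t : ℕ) : ℚ[X] →+* ℂ :=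
  eval₂RingHom (algebraMap ℚ ℂ) ((a : ℂ) + (t : ℂ)⁻¹)

theorem evalNear_apply (a : ℚ) (t : ℕ) (p : ℚ[X]) :
    evalNear a t p = algebraMap ℚ ℂ (p.eval (a + (t : ℚ)⁻¹)) := by
  have : (a : ℂ) + (t : ℂ)⁻¹ = algebraMap ℚ ℂ (a + (t : ℚ)⁻¹) := by simp
  rw [evalNear, coe_eval₂RingHom, this, eval₂_at_apply]

theorem eval_reflect_inv_mul_pow (p : ℚ[X]) {K : ℕ} (hK : p.natDegree ≤ K) {t : ℕ} (ht : 0 < t) :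
    algebraMap ℚ ℂ ((p.reflect K).eval (t : ℚ)⁻¹) * (t : ℂ) ^ K = p.aeval (t : ℂ) := by
  have ht' : (t : ℚ) ≠ 0 := by positivity
  have : Invertible (t : ℚ) := invertibleOfNonzero ht'
  have h := eval₂_reflect_mul_pow (RingHom.id ℚ) (t : ℚ) K p hK
  rw [invOf_eq_inv] at h
  have h2 : p.aeval (t : ℂ) = algebraMap ℚ ℂ (p.eval (t : ℚ)) := by
    rw [← aeval_algebraMap_apply_eq_algebraMap_eval]; simp
  rw [h2, eval, eval, ← h]
  simp

theorem exists_coeff_not_eventually_polynomial {ι : Type*} {F : ℚ[X][X]} (hF : F.Monic)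
    (hirr : Irreducible F) (a : ℚ) (S : Finset ι) (r : ι → ℕ → ℂ) (hS : S.Nonempty)
    (hlt : S.card < F.natDegree)
    (hroot : ∀ z ∈ S, ∀ᶠ t : ℕ in atTop, (F.map (evalNear a t)).eval (r z t) = 0)
    (M : ℕ) {c : ℂ} (hc : c ≠ 0) :
    ∃ j, ¬ ∃ p : ℚ[X], ∀ᶠ t : ℕ in atTop,
      (t : ℂ) ^ M * (c * (∏ z ∈ S, (X - C (r z t))).coeff j) = p.aeval (t : ℂ) := by
  by_contra! hall
  choose p hp using hall
  set m := S.card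
  set K := (Finset.range (m + 1)).sup fun j => (p j).natDegree
  set Q : ℕ → ℚ[X] := fun j => ((p j).reflect K).comp (X - C a)
  set G : ℚ[X][X] := ∑ j ∈ Finset.range (m + 1), C (Q j) * X ^ j
  have hGc : ∀ j, G.coeff j = if j < m + 1 then Q j else 0 := by
    intro j
    simp [G, coeff_C_mul, coeff_X_pow]
  have hQ : ∀ j < m + 1, ∀ t : ℕ, 0 < t →
      evalNear a t (Q j) * (t : ℂ) ^ K = (p j).aeval (t : ℂ) := by
    intro j hj t ht
    have hjK : (p j).natDegree ≤ K :=
      Finset.le_sup (f := fun j => (p j).natDegree) (Finset.mem_range.mpr hj)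
    rw [← eval_reflect_inv_mul_pow (p j) hjK ht, evalNear_apply]
    simp [Q]
  have hev : ∀ᶠ t : ℕ in atTop, C ((t : ℂ) ^ K) * G.map (evalNear a t) =
      C ((t : ℂ) ^ M * c) * ∏ z ∈ S, (X - C (r z t)) := by
    have h1 : ∀ᶠ t : ℕ in atTop, ∀ j ∈ Finset.range (m + 1),
        (t : ℂ) ^ M * (c * (∏ z ∈ S, (X - C (r z t))).coeff j) = (p j).aeval (t : ℂ) :=
      (Finset.eventually_all _).mpr fun j _ => hp j
    filter_upwards [h1, eventually_gt_atTop 0] with t ht htpos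
    ext j
    rw [coeff_C_mul, coeff_C_mul, coeff_map, hGc]
    split_ifs with hj
    · rw [mul_comm, hQ j hj t htpos, ← ht j (Finset.mem_range.mpr hj), mul_assoc]
    · rw [map_zero, mul_zero, coeff_eq_zero_of_natDegree_lt, mul_zero]
      rw [natDegree_prod_of_monic _ _ fun z _ => monic_X_sub_C _]
      simp only [natDegree_X_sub_C, Finset.sum_const, smul_eq_mul, mul_one]
      change m < j
      omega
  have hG0 : G ≠ 0 := by
    intro h0
    obtain ⟨t, ht, htpos⟩ := (hev.and (eventually_gt_atTop 0)).exists
    rw [h0, Polynomial.map_zero, mul_zero] at ht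
    have ht' : (t : ℂ) ≠ 0 := by exact_mod_cast htpos.ne'
    have h2 : (∏ z ∈ S, (X - C (r z t))) ≠ 0 :=
      (monic_prod_of_monic _ _ fun z _ => monic_X_sub_C _).ne_zero
    exact mul_ne_zero (C_ne_zero.mpr (mul_ne_zero (pow_ne_zero _ ht') hc)) h2 ht.symm
  have hGdeg : G.natDegree < F.natDegree := by
    refine lt_of_le_of_lt ?_ hlt
    refine natDegree_le_iff_coeff_eq_zero.mpr fun j hj => ?_
    rw [hGc, if_neg (by omega)]
  obtain ⟨U, V, ρ, hρ, hUV⟩ := exists_bezout_of_irreducible hF hirr hG0 hGdeg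
  obtain ⟨z, hz⟩ := hS
  have hzero : ∀ᶠ t : ℕ in atTop, ρ.eval (a + (t : ℚ)⁻¹) = 0 := by
    filter_upwards [hev, hroot z hz, eventually_gt_atTop 0] with t ht hr htpos
    have ht' : (t : ℂ) ≠ 0 := by exact_mod_cast htpos.ne'
    have hGr : (G.map (evalNear a t)).eval (r z t) = 0 := by
      have := congrArg (eval (r z t)) ht
      rw [eval_mul, eval_mul, eval_prod, Finset.prod_eq_zero hz (by simp), mul_zero, eval_C] at this
      exact (mul_eq_zero.mp this).resolve_left (pow_ne_zero _ ht')
    have h := congrArg (fun q => (q.map (evalNear a t)).eval (r z t)) hUV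
    simp only [Polynomial.map_add, Polynomial.map_mul, eval_add, eval_mul, hr, hGr, mul_zero,
      add_zero, Polynomial.map_C, eval_C] at h
    rw [evalNear_apply] at h
    exact (map_eq_zero _).mp h.symm
  obtain ⟨T, hT⟩ := eventually_atTop.mp hzero
  refine hρ (eq_zero_of_infinite_isRoot ρ ?_)
  refine ((Set.Ici_infinite T).image (f := fun t : ℕ => a + (t : ℚ)⁻¹) ?_).mono ?_
  · intro s _ t _ hst
    simpa using hst
  · rintro _ ⟨t, ht, rfl⟩
    exact hT t ht

theorem exists_factor_of_not_irreducible {f : ℚ[X]} (hf : f.Monic) (hdeg : 0 < f.natDegree)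
    (hred : ¬ Irreducible f) :
    ∃ g : ℚ[X], g.Monic ∧ g ∣ f ∧ 0 < g.natDegree ∧ g.natDegree < f.natDegree := by
  have h1 : f ≠ 1 := by rintro rfl; simp at hdeg
  rw [hf.irreducible_iff_natDegree'] at hred
  push Not at hred
  obtain ⟨p, q, hp, hq, hpq, hmem⟩ := hred h1
  have hsum : p.natDegree + q.natDegree = f.natDegree := by rw [← hpq, hp.natDegree_mul hq]
  rw [Finset.mem_Ioc] at hmem
  exact ⟨q, hq, ⟨p, by rw [← hpq, mul_comm]⟩, by omega, by omega⟩

/-- Hilbert's irreducibility theorem for monic polynomials over `ℚ`. -/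
theorem hilbert_irreducibility {F : ℚ[X][X]} (hF : F.Monic) (hirr : Irreducible F) :
    {x : ℚ | Irreducible (F.map (evalRingHom x))}.Infinite := by
  classical
  obtain ⟨a, ha⟩ := exists_separable_specialization hF hirr
  set P : ℂ[X][X] := F.map (mapRingHom (algebraMap ℚ ℂ))
  have hP : P.Monic := hF.map _
  have hPmap : ∀ x : ℚ, P.map (evalRingHom (x : ℂ)) =
      (F.map (evalRingHom x)).map (algebraMap ℚ ℂ) := by
    intro x
    rw [Polynomial.map_map, Polynomial.map_map]
    congr 1
    ext p
    · simp
    · simp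
  have hPdeg : P.natDegree = F.natDegree := hF.natDegree_map _
  obtain ⟨R, y, hRcard, hy, hfac⟩ := exists_analytic_roots P hP (a : ℂ)
    (by rw [hPmap]; exact ha.map)
  rw [hPdeg] at hRcard
  set n := F.natDegree with hn
  have hn0 : 0 < n := Nat.pos_of_ne_zero fun h0 =>
    hirr.not_isUnit (by rw [hF.natDegree_eq_zero.mp h0]; exact isUnit_one)
  obtain ⟨D, e, hD, hDe⟩ := exists_int_eq_mul_coeff_map_eval a F
  set M := e * n
  have hDC : ((D : ℂ) ^ n) ≠ 0 := pow_ne_zero _ (by exact_mod_cast hD.ne')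
  have hinv : Tendsto (fun t : ℕ => (t : ℂ)⁻¹) atTop (𝓝 0) :=
    tendsto_inv_atTop_nhds_zero_nat
  have hnear : ∀ t : ℕ, (F.map (evalRingHom (a + (t : ℚ)⁻¹))).map (algebraMap ℚ ℂ) =
      F.map (evalNear a t) := by
    intro t
    rw [Polynomial.map_map]
    congr 1
    ext p
    · simp
    · simp [evalNear]
  have hfac' : ∀ᶠ t : ℕ in atTop, F.map (evalNear a t) = ∏ z ∈ R, (X - C (y z (t : ℂ)⁻¹)) := by
    filter_upwards [hinv.eventually hfac] with t ht
    rw [← ht, ← hnear, ← hPmap]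
    push_cast
    rfl
  set 𝒮 : Finset (Finset ℂ) := R.powerset.filter fun S => S.Nonempty ∧ S.card < n
  have hbound : ∀ H : ℕ, ∀ S ∈ 𝒮, ∃ j, ∃ T₀ : ℕ, ∀ T ≥ T₀, ∀ s ⊆ Finset.Icc T (T + H),
      (∀ t ∈ s, ∃ m : ℤ, (t : ℂ) ^ M *
        ((D : ℂ) ^ n * (∏ z ∈ S, (X - C (y z (t : ℂ)⁻¹))).coeff j) = m) → s.card ≤ M + 1 := by
    intro H S hS
    obtain ⟨hSR, hSne, hSlt⟩ := Finset.mem_filter.mp hS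
    rw [Finset.mem_powerset] at hSR
    obtain ⟨j, hj⟩ := exists_coeff_not_eventually_polynomial hF hirr a S
      (fun z t => y z (t : ℂ)⁻¹) hSne hSlt (fun z hz => by
        filter_upwards [hfac'] with t ht
        rw [ht, eval_prod, Finset.prod_eq_zero (hSR hz) (by simp)]) M hDC
    have han : AnalyticAt ℂ
        (fun s => (D : ℂ) ^ n * (∏ z ∈ S, (X - C (y z s))).coeff j) 0 :=
      analyticAt_const.mul (analyticAt_coeff_prod S y (fun z hz => hy z (hSR hz)) j)
    exact ⟨j, (card_integral_le_or_eventually_polynomial han M H).resolve_right hj⟩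
  set H := 𝒮.card * (M + 1)
  choose! j T₀ hT₀ using hbound H
  obtain ⟨T₁, hT₁⟩ := eventually_atTop.mp hfac'
  have hgood : ∀ T : ℕ, ∃ t > T, Irreducible (F.map (evalRingHom (a + (t : ℚ)⁻¹))) := by
    intro T'
    by_contra! hbad
    set T := (T' + 1) + T₁ + 𝒮.sup T₀
    have hfactor : ∀ t ∈ Finset.Icc T (T + H), ∃ S ∈ 𝒮, ∀ j, ∃ m : ℤ, (t : ℂ) ^ M *
        ((D : ℂ) ^ n * (∏ z ∈ S, (X - C (y z (t : ℂ)⁻¹))).coeff j) = m := by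
      intro t ht
      have htT := (Finset.mem_Icc.mp ht).1
      have hft : (F.map (evalRingHom (a + (t : ℚ)⁻¹))).Monic := hF.map _
      have hfn : (F.map (evalRingHom (a + (t : ℚ)⁻¹))).natDegree = n := hF.natDegree_map _
      obtain ⟨g, hg, hdvd, hg0, hglt⟩ := exists_factor_of_not_irreducible hft
        (by rw [hfn]; exact hn0) (hbad t (by omega))
      have hfR := hT₁ t (by omega)
      rw [← hnear] at hfR
      obtain ⟨S, hSR, hgS⟩ := exists_subset_prod_eq_of_dvd R (fun z => y z (t : ℂ)⁻¹)
        (hg.map (algebraMap ℚ ℂ)) (by rw [← hfR]; exact Polynomial.map_dvd _ hdvd)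
      have hcard : S.card = g.natDegree := by
        have h1 : (g.map (algebraMap ℚ ℂ)).natDegree = g.natDegree := hg.natDegree_map _
        rw [← h1, hgS, natDegree_prod_of_monic _ _ fun z _ => monic_X_sub_C _]
        simp
      refine ⟨S, Finset.mem_filter.mpr ⟨Finset.mem_powerset.mpr hSR,
        Finset.card_pos.mp (by omega), by omega⟩, fun j => ?_⟩
      obtain ⟨m, hm⟩ := exists_int_eq_pow_mul_coeff_prod (D * t ^ e) _ hft
        (fun i => by push_cast; exact hDe t (by omega) i) R S hSR
        (fun z => y z (t : ℂ)⁻¹) hfR g hgS j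
      refine ⟨m, ?_⟩
      rw [← hm, hRcard]
      push_cast
      ring
    choose! σ hσ hσint using hfactor
    have hcount : (Finset.Icc T (T + H)).card ≤ 𝒮.card * (M + 1) := by
      rw [mul_comm]
      refine Finset.card_le_mul_card_image_of_maps_to (f := σ) hσ (M + 1) fun S hS => ?_
      refine hT₀ S hS T ?_ _ (Finset.filter_subset _ _) fun t ht => ?_
      · have := Finset.le_sup (f := T₀) hS
        simp only [T]; omega
      · obtain ⟨ht, rfl⟩ := Finset.mem_filter.mp ht
        exact hσint t (by assumption) _
    rw [Nat.card_Icc] at hcount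
    change T + H + 1 - T ≤ H at hcount
    omega
  have hinf : {t : ℕ | Irreducible (F.map (evalRingHom (a + (t : ℚ)⁻¹)))}.Infinite :=
    Set.infinite_of_forall_exists_gt fun T => by
      obtain ⟨t, ht, h⟩ := hgood T
      exact ⟨t, h, ht⟩
  refine (hinf.image (f := fun t : ℕ => a + (t : ℚ)⁻¹) ?_).mono ?_
  · intro s _ t _ hst
    simpa using hst
  · rintro _ ⟨t, ht, rfl⟩
    exact ht

end HilbertIrreducibility

section PrimitiveElement

open IntermediateField in
/-- A domain that is finitely generated and algebraic over `k[X]`, with `k` of characteristic zero,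
contains an integral element generating its fraction field. -/
theorem exists_isIntegral_card_le_natDegree_minpoly {k B : Type*} [Field k] [CharZero k]
    [CommRing B] [IsDomain B] [Algebra k[X] B] [FaithfulSMul k[X] B] (s : Set B) (hfin : s.Finite)
    (hs : Algebra.adjoin k[X] s = ⊤) (halg : ∀ b ∈ s, IsAlgebraic k[X] b)
    {ι : Type*} [Fintype ι] {v : ι → B} (hv : LinearIndependent k[X] v) :
    ∃ z : B, IsIntegral k[X] z ∧ Fintype.card ι ≤ (minpoly k[X] z).natDegree := by
  classical
  have hB : Algebra.IsAlgebraic k[X] B := by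
    refine ⟨fun b => ?_⟩
    have hle : Algebra.adjoin k[X] s ≤ Subalgebra.algebraicClosure k[X] B :=
      Algebra.adjoin_le fun b hb => halg b hb
    exact hle (hs ▸ Algebra.mem_top)
  set E := FractionRing B
  have : FaithfulSMul k[X] E := FaithfulSMul.trans k[X] B E
  set K := FractionRing k[X]
  let _ : Algebra K E := FractionRing.liftAlgebra k[X] E
  have : IsScalarTower k[X] K E := inferInstance
  have hBE : Algebra.IsAlgebraic B E := IsLocalization.isAlgebraic E (nonZeroDivisors B)
  have hkE : Algebra.IsAlgebraic k[X] E := Algebra.IsAlgebraic.trans k[X] B E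
  have hKE : Algebra.IsAlgebraic K E := IsFractionRing.comap_isAlgebraic_iff.mp hkE
  have hgen : IntermediateField.adjoin K (algebraMap B E '' s) = ⊤ := by
    set W := IntermediateField.adjoin K (algebraMap B E '' s)
    have hBW : ∀ b : B, algebraMap B E b ∈ W := by
      intro b
      have hb : b ∈ Algebra.adjoin k[X] s := hs ▸ Algebra.mem_top
      induction hb using Algebra.adjoin_induction with
      | mem x hx => exact IntermediateField.subset_adjoin _ _ ⟨x, hx, rfl⟩
      | algebraMap r =>
        rw [← IsScalarTower.algebraMap_apply, IsScalarTower.algebraMap_apply k[X] K E]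
        exact W.algebraMap_mem _
      | add x y _ _ hx hy => rw [map_add]; exact add_mem hx hy
      | mul x y _ _ hx hy => rw [map_mul]; exact mul_mem hx hy
    refine eq_top_iff.mpr fun x _ => ?_
    obtain ⟨b, c, _, rfl⟩ := IsFractionRing.div_surjective (A := B) x
    exact div_mem (hBW b) (hBW c)
  have hfd : FiniteDimensional K E := by
    have : Finite (algebraMap B E '' s) := (hfin.image _).to_subtype
    have h1 : FiniteDimensional K (IntermediateField.adjoin K (algebraMap B E '' s)) :=
      IntermediateField.finiteDimensional_adjoin fun x _ => (hKE.isAlgebraic x).isIntegral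
    rw [hgen] at h1
    exact (IntermediateField.topEquiv (F := K) (E := E)).toLinearEquiv.finiteDimensional
  have : CharZero K := charZero_of_injective_algebraMap (IsFractionRing.injective k[X] K)
  obtain ⟨x, hx⟩ := Field.exists_primitive_element K E
  obtain ⟨b, c, hc, rfl⟩ := IsFractionRing.div_surjective (A := B) x
  obtain ⟨r, hr, d, hd⟩ := (hB.isAlgebraic c).exists_nonzero_dvd hc
  obtain ⟨r', hr', hint⟩ := (hB.isAlgebraic (b * d)).exists_integral_multiple
  refine ⟨r' • (b * d), hint, ?_⟩
  have hmul : algebraMap B E b / algebraMap B E c =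
      (algebraMap k[X] K (r' * r))⁻¹ • algebraMap B E (r' • (b * d)) := by
    have hc' : algebraMap B E c ≠ 0 := IsFractionRing.to_map_ne_zero_of_mem_nonZeroDivisors hc
    have hrr : algebraMap k[X] E (r' * r) ≠ 0 := by
      rw [Ne, FaithfulSMul.algebraMap_eq_zero_iff]; exact mul_ne_zero hr' hr
    rw [Algebra.smul_def, map_inv₀, ← IsScalarTower.algebraMap_apply, Algebra.smul_def,
      map_mul (algebraMap B E), ← IsScalarTower.algebraMap_apply, div_eq_iff hc', map_mul,
      IsScalarTower.algebraMap_apply k[X] B E r, hd]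
    rw [map_mul, IsScalarTower.algebraMap_apply k[X] B E r, hd] at hrr
    simp only [map_mul] at hrr ⊢
    generalize algebraMap B E b = b', algebraMap B E c = c', algebraMap B E d = d',
      algebraMap k[X] E r' = r₁ at hrr ⊢
    rw [mul_assoc, eq_inv_mul_iff_mul_eq₀ hrr]
    ring
  have htop : K⟮algebraMap B E (r' • (b * d))⟯ = ⊤ := by
    rw [eq_top_iff, ← hx, IntermediateField.adjoin_simple_le_iff, hmul]
    exact IntermediateField.smul_mem _ (IntermediateField.mem_adjoin_simple_self K _)
  rw [Field.primitive_element_iff_minpoly_natDegree_eq,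
    minpoly.isIntegrallyClosed_eq_field_fractions K E hint,
    natDegree_map_eq_of_injective (IsFractionRing.injective k[X] K)] at htop
  rw [htop]
  have hvE : LinearIndependent k[X] fun i => algebraMap B E (v i) :=
    hv.map' (IsScalarTower.toAlgHom k[X] B E).toLinearMap
      (LinearMap.ker_eq_bot.mpr (IsFractionRing.injective B E))
  exact (LinearIndependent.iff_fractionRing k[X] K |>.mp hvE).fintype_card_le_finrank

attribute [local instance] Polynomial.algebra

theorem exists_minpoly_dvd {k L : Type*} [Field k] [CharZero k] [Field L] [Algebra k L]
    [FiniteDimensional k L] {f : L[X][X]} (hf : Irreducible f) (hdeg : 0 < f.natDegree) :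
    ∃ (G : k[X][X]) (q : L[X][X]), G.Monic ∧ Irreducible G ∧
      Module.finrank k L * f.natDegree ≤ G.natDegree ∧
      f ∣ G.eval₂ (C.comp (mapRingHom (algebraMap k L))) q := by
  classical
  have hprime : Prime f := hf.prime
  have : IsDomain (AdjoinRoot f) := AdjoinRoot.isDomain_of_prime hprime
  have hCinj : Function.Injective (AdjoinRoot.of f) := by
    refine (injective_iff_map_eq_zero _).mpr fun c hc => ?_
    have hdvd : f ∣ C c := AdjoinRoot.mk_eq_zero.mp hc
    by_contra h0
    have := natDegree_le_of_dvd hdvd (C_ne_zero.mpr h0)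
    rw [natDegree_C] at this
    omega
  have hinj : Function.Injective (algebraMap k[X] (AdjoinRoot f)) := by
    rw [IsScalarTower.algebraMap_eq k[X] L[X] (AdjoinRoot f)]
    exact hCinj.comp (Polynomial.map_injective _ (algebraMap k L).injective)
  have : FaithfulSMul k[X] (AdjoinRoot f) := (faithfulSMul_iff_algebraMap_injective _ _).mpr hinj
  have hmap : ∀ p : k[X], algebraMap k[X] (AdjoinRoot f) p =
    AdjoinRoot.mk f (C (p.map (algebraMap k L))) := fun p => rfl
  set bs := Module.finBasis k L
  set N := f.natDegree
  set v : Fin (Module.finrank k L) × Fin N → AdjoinRoot f :=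
    fun ij => AdjoinRoot.mk f (C (C (bs ij.1)) * X ^ (ij.2 : ℕ))
  have hv : LinearIndependent k[X] v := by
    rw [Fintype.linearIndependent_iff]
    intro g hg
    set P : Fin N → L[X] := fun j => ∑ i, (g (i, j)).map (algebraMap k L) * C (bs i)
    have hP : AdjoinRoot.mk f (∑ j : Fin N, C (P j) * X ^ (j : ℕ)) = 0 := by
      rw [← hg, Fintype.sum_prod_type_right, map_sum]
      refine Finset.sum_congr rfl fun j _ => ?_
      simp only [P, map_sum, Finset.sum_mul]
      refine Finset.sum_congr rfl fun i _ => ?_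
      rw [Algebra.smul_def, hmap, ← map_mul, ← mul_assoc, ← C_mul]
    have hP0 : ∑ j : Fin N, C (P j) * X ^ (j : ℕ) = 0 := by
      by_contra h0
      have h1 := degree_le_of_dvd (AdjoinRoot.mk_eq_zero.mp hP) h0
      refine h1.not_gt ((degree_sum_fin_lt P).trans_le ?_)
      rw [degree_eq_natDegree hf.ne_zero]
    rintro ⟨i, j⟩
    have hPj : P j = 0 := by
      have := congrArg (fun p => p.coeff j) hP0
      simpa [finsetSum_coeff, coeff_C_mul, coeff_X_pow, Fin.val_inj] using this
    ext m
    have hm : ∑ i, (g (i, j)).coeff m • bs i = 0 := by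
      have := congrArg (fun p => p.coeff m) hPj
      simpa [P, finsetSum_coeff, Algebra.smul_def] using this
    simpa using Fintype.linearIndependent_iff.mp bs.linearIndependent _ hm i
  set s : Set (AdjoinRoot f) :=
    insert (AdjoinRoot.root f) (Set.range fun i => AdjoinRoot.of f (C (bs i)))
  have hs : Algebra.adjoin k[X] s = ⊤ := by
    refine eq_top_iff.mpr fun z _ => ?_
    set W := Algebra.adjoin k[X] s
    have hX : AdjoinRoot.of f X ∈ W := by
      have := W.algebraMap_mem (X : k[X])
      rwa [hmap, Polynomial.map_X] at this
    have hc : ∀ c : L, AdjoinRoot.of f (C c) ∈ W := by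
      intro c
      rw [← bs.sum_repr c, map_sum, map_sum]
      refine sum_mem fun i _ => ?_
      rw [Algebra.smul_def, C_mul, map_mul]
      refine mul_mem ?_ (Algebra.subset_adjoin (Or.inr ⟨i, rfl⟩))
      have := W.algebraMap_mem (C (bs.repr c i) : k[X])
      rwa [hmap, Polynomial.map_C] at this
    have hcX : ∀ c : L[X], AdjoinRoot.of f c ∈ W := by
      intro c
      rw [c.as_sum_range_C_mul_X_pow, map_sum]
      refine sum_mem fun i _ => ?_
      rw [map_mul, map_pow]
      exact mul_mem (hc _) (pow_mem hX _)
    obtain ⟨p, rfl⟩ := AdjoinRoot.mk_surjective z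
    rw [p.as_sum_range_C_mul_X_pow, map_sum]
    refine sum_mem fun i _ => ?_
    rw [map_mul, map_pow]
    exact mul_mem (hcX _) (pow_mem (Algebra.subset_adjoin (Set.mem_insert _ _)) _)
  have halg : ∀ b ∈ s, IsAlgebraic k[X] b := by
    intro b hb
    rcases hb with rfl | ⟨i, rfl⟩
    · have : IsAlgebraic L[X] (AdjoinRoot.root f) :=
        ⟨f, hf.ne_zero, by rw [AdjoinRoot.aeval_eq, AdjoinRoot.mk_self]⟩
      exact this.restrictScalars k[X]
    · exact (Algebra.IsAlgebraic.isAlgebraic (R := k[X]) (C (bs i))).algebraMap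
        (A := AdjoinRoot f)
  obtain ⟨z, hz, hcard⟩ := exists_isIntegral_card_le_natDegree_minpoly s
    ((Set.finite_range _).insert _) hs halg hv
  obtain ⟨q, rfl⟩ := AdjoinRoot.mk_surjective z
  refine ⟨minpoly k[X] (AdjoinRoot.mk f q), q, minpoly.monic hz, minpoly.irreducible hz, ?_, ?_⟩
  · simpa using hcard
  · rw [← AdjoinRoot.mk_eq_zero, hom_eval₂]
    exact minpoly.aeval k[X] (AdjoinRoot.mk f q)

end PrimitiveElement

section Avoidance

open IntermediateField

theorem exists_natDegree_le_natDegree_minpoly {L Ω : Type*} [Field L] [Field Ω] [Algebra ℚ L]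
    [FiniteDimensional ℚ L] [Algebra L Ω] [Algebra ℚ Ω] [IsScalarTower ℚ L Ω] {f : L[X][X]}
    (hf : Irreducible f) (hdeg : 0 < f.natDegree) :
    ∃ x : ℚ, (f.map (evalRingHom (algebraMap ℚ L x))).natDegree = f.natDegree ∧
      ∀ y : Ω, aeval y (f.map (evalRingHom (algebraMap ℚ L x))) = 0 →
        f.natDegree ≤ (minpoly L y).natDegree := by
  classical
  obtain ⟨G, q, hG, hGirr, hGdeg, hdvd⟩ := exists_minpoly_dvd (k := ℚ) hf hdeg
  obtain ⟨x, hx, hlead⟩ : ∃ x ∈ {x : ℚ | Irreducible (G.map (evalRingHom x))},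
      f.leadingCoeff.eval (algebraMap ℚ L x) ≠ 0 := by
    by_contra! hall
    refine (leadingCoeff_ne_zero.mpr hf.ne_zero) (eq_zero_of_infinite_isRoot _ ?_)
    refine ((hilbert_irreducibility hG hGirr).image (algebraMap ℚ L).injective.injOn).mono ?_
    rintro _ ⟨x, hx, rfl⟩
    exact hall x hx
  set ev : L[X] →+* L := evalRingHom (algebraMap ℚ L x)
  have hfx : (f.map ev).natDegree = f.natDegree := natDegree_map_of_leadingCoeff_ne_zero _ hlead
  refine ⟨x, hfx, fun y hy => ?_⟩
  have hfx0 : f.map ev ≠ 0 := fun h0 => by rw [h0, natDegree_zero] at hfx; omega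
  have hint : IsIntegral L y := IsAlgebraic.isIntegral ⟨_, hfx0, hy⟩
  have hfin : FiniteDimensional L L⟮y⟯ := adjoin.finiteDimensional hint
  have : FiniteDimensional ℚ L⟮y⟯ := FiniteDimensional.trans ℚ L L⟮y⟯
  set y₁ : L⟮y⟯ := AdjoinSimple.gen L y
  have hy₁ : aeval y₁ (f.map ev) = 0 := by
    apply (algebraMap L⟮y⟯ Ω).injective
    rw [← aeval_algebraMap_apply, AdjoinSimple.algebraMap_gen, hy, map_zero]
  set θ : L[X][X] →+* L⟮y⟯ := ((aeval y₁).toRingHom : L[X] →+* L⟮y⟯).comp (mapRingHom ev)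
  have hθf : θ f = 0 := hy₁
  have hθ : aeval (θ q) (G.map (evalRingHom x)) = 0 := by
    have h0 : θ (G.eval₂ (C.comp (mapRingHom (algebraMap ℚ L))) q) = 0 := by
      obtain ⟨c, hc⟩ := hdvd
      rw [hc, map_mul, hθf, zero_mul]
    rw [hom_eval₂] at h0
    rw [aeval_def, eval₂_map, ← h0]
    congr 1
    ext
    · simp
    · simp [θ, ev]
  have hmin : G.map (evalRingHom x) = minpoly ℚ (θ q) :=
    minpoly.eq_of_irreducible_of_monic hx hθ (hG.map _)
  have h1 : G.natDegree ≤ Module.finrank ℚ L⟮y⟯ := by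
    rw [← hG.natDegree_map (evalRingHom x), hmin]
    exact minpoly.natDegree_le _
  rw [← Module.finrank_mul_finrank ℚ L L⟮y⟯, adjoin.finrank hint] at h1
  exact Nat.le_of_mul_le_mul_left (hGdeg.trans h1) Module.finrank_pos

theorem mem_range_of_mem_adjoin_simple {K L Ω : Type*} [Field K] [Field L] [Field Ω] [Algebra K L]
    [Algebra L Ω] [Algebra K Ω] [IsScalarTower K L Ω] {y : Ω} (hy : IsIntegral K y)
    (hdeg : (minpoly K y).natDegree ≤ (minpoly L y).natDegree) {b : L}
    (hb : algebraMap L Ω b ∈ K⟮y⟯) : b ∈ Set.range (algebraMap K L) := by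
  rw [← mem_toSubalgebra, adjoin_simple_toSubalgebra_of_isAlgebraic hy.isAlgebraic,
    Algebra.adjoin_singleton_eq_range_aeval] at hb
  obtain ⟨p, hp⟩ := hb
  have hp' : aeval y (p %ₘ minpoly K y) = algebraMap L Ω b := by
    rw [aeval_modByMonic_eq_self_of_root (minpoly.aeval K y)]; exact hp
  set r := p %ₘ minpoly K y
  have hr : r.natDegree < (minpoly K y).natDegree :=
    natDegree_modByMonic_lt _ (minpoly.monic hy) (minpoly.ne_one K y)
  have h0 : r.map (algebraMap K L) - C b = 0 := by
    by_contra hne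
    have h1 : (minpoly L y).natDegree ≤ _ :=
      natDegree_le_of_dvd (minpoly.dvd L y (by simp [hp'])) hne
    have h2 : (r.map (algebraMap K L) - C b).natDegree ≤ r.natDegree := by
      rw [natDegree_sub_C, natDegree_map]
    omega
  have := congrArg (fun p => p.coeff 0) (sub_eq_zero.mp h0)
  exact ⟨r.coeff 0, by simpa using this⟩

theorem isLocalHom_mapRingHom {R S : Type*} [CommRing R] [CommRing S] [IsDomain S] (φ : R →+* S)
    [IsLocalHom φ] (hφ : Function.Injective φ) : IsLocalHom (mapRingHom φ) := by
  refine ⟨fun p hp => ?_⟩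
  rw [coe_mapRingHom] at hp
  have h0 := natDegree_eq_zero_of_isUnit hp
  rw [natDegree_map_eq_of_injective hφ] at h0
  rw [eq_C_of_natDegree_eq_zero h0, Polynomial.map_C, isUnit_C] at hp
  rw [eq_C_of_natDegree_eq_zero h0]
  exact isUnit_C.mpr (isUnit_of_map_unit φ _ hp)

theorem irreducible_of_map_mapRingHom {K L : Type*} [Field K] [Field L] (φ : K →+* L) {f : K[X][X]}
    (hf : Irreducible (f.map (mapRingHom φ))) : Irreducible f := by
  have := isLocalHom_mapRingHom φ φ.injective
  have := isLocalHom_mapRingHom (mapRingHom φ) (Polynomial.map_injective φ φ.injective)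
  exact Irreducible.of_map (f := mapRingHom (mapRingHom φ)) hf

/-- An absolutely irreducible curve over a number field has a point over an extension avoiding
finitely many prescribed algebraic numbers. -/
theorem exists_zero_avoiding {K Ω : Type*} [Field K] [Field Ω] [Algebra ℚ K]
    [FiniteDimensional ℚ K] [Algebra K Ω] [Algebra ℚ Ω] [IsScalarTower ℚ K Ω] [IsAlgClosed Ω]
    [Algebra.IsAlgebraic K Ω] (f : K[X][X]) (hf : Irreducible (f.map (mapRingHom (algebraMap K Ω))))
    {B : Set Ω} (hfin : B.Finite) (hB : ∀ b ∈ B, b ∉ Set.range (algebraMap K Ω)) :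
    ∃ (x : K) (y : Ω), aeval y (f.map (evalRingHom x)) = 0 ∧ ∀ b ∈ B, b ∉ K⟮y⟯ := by
  rcases Nat.eq_zero_or_pos f.natDegree with h0 | hpos
  · rw [eq_C_of_natDegree_eq_zero h0, Polynomial.map_C] at hf
    have hirr := Irreducible.of_map (f := (C : Polynomial Ω →+* _)) hf
    have hd := IsAlgClosed.degree_eq_one_of_irreducible Ω hirr
    rw [coe_mapRingHom, degree_map] at hd
    obtain ⟨x, hx⟩ := exists_root_of_degree_eq_one hd
    refine ⟨x, 0, ?_, fun b hb hbK => hB b hb ?_⟩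
    · rw [eq_C_of_natDegree_eq_zero h0, Polynomial.map_C, aeval_C, coe_evalRingHom, hx.eq_zero,
        map_zero]
    · rwa [adjoin_zero, IntermediateField.mem_bot] at hbK
  · set L : IntermediateField K Ω := adjoin K B
    have : Finite B := hfin.to_subtype
    have : FiniteDimensional K L :=
      finiteDimensional_adjoin fun x _ => (Algebra.IsAlgebraic.isAlgebraic x).isIntegral
    have : FiniteDimensional ℚ L := FiniteDimensional.trans ℚ K L
    set fL : L[X][X] := f.map (mapRingHom (algebraMap K L))
    have hfL : Irreducible fL := by
      refine irreducible_of_map_mapRingHom (algebraMap L Ω) ?_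
      rwa [Polynomial.map_map, mapRingHom_comp, ← IsScalarTower.algebraMap_eq]
    have hfLdeg : fL.natDegree = f.natDegree :=
      natDegree_map_eq_of_injective (Polynomial.map_injective _ (algebraMap K L).injective) f
    obtain ⟨x, hx, hxy⟩ := exists_natDegree_le_natDegree_minpoly (Ω := Ω) hfL
      (by rwa [hfLdeg])
    have hmap : fL.map (evalRingHom (algebraMap ℚ L x)) =
        (f.map (evalRingHom (algebraMap ℚ K x))).map (algebraMap K L) := by
      rw [Polynomial.map_map, Polynomial.map_map]
      congr 1
      ext
      · simp
      · simp
    rw [hmap, natDegree_map, hfLdeg] at hx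
    set fx := f.map (evalRingHom (algebraMap ℚ K x))
    have hfx0 : fx ≠ 0 := by
      rintro h
      rw [h, natDegree_zero] at hx
      omega
    obtain ⟨y, hy⟩ := IsAlgClosed.exists_aeval_eq_zero Ω fx
      (by
      rw [degree_eq_natDegree hfx0, hx]; exact_mod_cast hpos.ne')
    refine ⟨algebraMap ℚ K x, y, hy, fun b hb hbK => hB b hb ?_⟩
    have hyint : IsIntegral K y := (Algebra.IsAlgebraic.isAlgebraic y).isIntegral
    have h1 := hxy y (by rw [hmap, aeval_map_algebraMap]; exact hy)
    have h2 : (minpoly K y).natDegree ≤ f.natDegree := by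
      rw [← hx]
      exact natDegree_le_of_dvd (minpoly.dvd K y hy) hfx0
    obtain ⟨c, hc⟩ := mem_range_of_mem_adjoin_simple (L := L) hyint (h2.trans (hfLdeg ▸ h1))
      (b := ⟨b, subset_adjoin K B hb⟩) hbK
    exact ⟨c, by rw [IsScalarTower.algebraMap_apply K L Ω, hc]; rfl⟩

end Avoidance

section Bivariate

theorem map_equivMvPolynomial {R S : Type*} [CommRing R] [CommRing S] (φ : R →+* S) (p : R[X][X]) :
    MvPolynomial.map φ (Bivariate.equivMvPolynomial R p) =
      Bivariate.equivMvPolynomial S (p.map (mapRingHom φ)) := by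
  have : (MvPolynomial.map φ).comp (Bivariate.equivMvPolynomial R).toRingEquiv.toRingHom =
      (Bivariate.equivMvPolynomial S).toRingEquiv.toRingHom.comp (mapRingHom (mapRingHom φ)) := by
    ext <;> simp
  exact RingHom.congr_fun this p

theorem eval_map_equivMvPolynomial {K Ω : Type*} [CommRing K] [CommRing Ω] [Algebra K Ω] (x : K)
    (y : Ω) (p : K[X][X]) :
    MvPolynomial.eval ![algebraMap K Ω x, y]
        (MvPolynomial.map (algebraMap K Ω) (Bivariate.equivMvPolynomial K p)) =
      aeval y (p.map (evalRingHom x)) := by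
  have : ((MvPolynomial.eval ![algebraMap K Ω x, y]).comp
        (MvPolynomial.map (algebraMap K Ω))).comp
          (Bivariate.equivMvPolynomial K).toRingEquiv.toRingHom =
      ((aeval y : K[X] →ₐ[K] Ω) : K[X] →+* Ω).comp (mapRingHom (evalRingHom x)) := by
    ext <;> simp
  exact RingHom.congr_fun this p

end Bivariate

section SubfieldSpace

instance : Algebra.IsAlgebraic ℚ Qbar := by
  convert AlgebraicClosure.isAlgebraic ℚ
  · rfl
  · exact Subsingleton.elim _ _

/-- The indicator function of a subfield. -/
def subfieldIndicator (F : Subfield Qbar) : Qbar → Bool :=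
  open Classical in fun q => decide (q ∈ F)

@[simp]
theorem subfieldIndicator_eq_true {F : Subfield Qbar} {q : Qbar} :
    subfieldIndicator F q = true ↔ q ∈ F := by
  simp [subfieldIndicator]

open Classical in
theorem induced_prop_eq_induced_decide {α : Type*} (p : α → Prop) :
    TopologicalSpace.induced p propDiscrete =
      TopologicalSpace.induced (fun x => decide (p x)) inferInstance := by
  let : TopologicalSpace Prop := propDiscrete
  ext s
  rw [@isOpen_induced_iff _ _ propDiscrete, isOpen_induced_iff]
  constructor
  · rintro ⟨t, -, rfl⟩
    exact ⟨{b | (b = true) ∈ t}, isOpen_discrete _, by ext x; simp⟩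
  · rintro ⟨t, -, rfl⟩
    exact ⟨{q | decide q ∈ t}, trivial, by ext x; simp⟩

theorem isInducing_subfieldIndicator : IsInducing subfieldIndicator := by
  classical
  refine ⟨?_⟩
  have h : subfieldTopology =
      ⨅ q : Qbar, TopologicalSpace.induced (fun F : Subfield Qbar => q ∈ F) propDiscrete :=
    induced_iInf.trans (congrArg iInf (funext fun q => induced_compose))
  rw [h, Pi.topologicalSpace, induced_iInf]
  refine congrArg iInf (funext fun q => ?_)
  rw [induced_prop_eq_induced_decide, induced_compose]
  rfl

theorem injective_subfieldIndicator : Function.Injective subfieldIndicator := fun F F' h => by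
  ext q
  rw [← subfieldIndicator_eq_true, h, subfieldIndicator_eq_true]

theorem isClosed_range_subfieldIndicator : IsClosed (Set.range subfieldIndicator) := by
  have h : Set.range subfieldIndicator =
      {u | u 1 = true} ∩ (⋂ (a : Qbar) (b : Qbar),
        {u | u a = true → u b = true → u (a * b) = true ∧ u (a + b) = true}) ∩
      ⋂ a : Qbar, {u | u a = true → u (-a) = true ∧ u a⁻¹ = true} := by
    ext u
    simp only [Set.mem_range, Set.mem_inter_iff, Set.mem_iInter, Set.mem_ofPred_eq]
    constructor
    · rintro ⟨F, rfl⟩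
      simp only [subfieldIndicator_eq_true]
      exact ⟨⟨F.one_mem, fun a b ha hb => ⟨F.mul_mem ha hb, F.add_mem ha hb⟩⟩,
        fun a ha => ⟨F.neg_mem ha, F.inv_mem ha⟩⟩
    · rintro ⟨⟨h1, h2⟩, h3⟩
      refine ⟨{ carrier := {q | u q = true}
                mul_mem' := fun {a b} ha hb => (h2 a b ha hb).1
                one_mem' := h1
                add_mem' := fun {a b} ha hb => (h2 a b ha hb).2
                zero_mem' := by
                  have := (h2 1 (-1) h1 (h3 1 h1).1).2
                  rwa [add_neg_cancel] at this
                neg_mem' := fun {a} ha => (h3 a ha).1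
                inv_mem' := fun a ha => (h3 a ha).2 }, ?_⟩
      funext q
      rw [Bool.eq_iff_iff, subfieldIndicator_eq_true]
      rfl
  rw [h]
  refine (IsClosed.inter ?_ ?_).inter ?_
  · exact (isClosed_discrete {b : Bool | b = true}).preimage
      (f := fun u : Qbar → Bool => u 1) (by fun_prop)
  · refine isClosed_iInter fun a => isClosed_iInter fun b => ?_
    exact (isClosed_discrete {v : Bool × Bool × Bool × Bool | v.1 = true → v.2.1 = true →
      v.2.2.1 = true ∧ v.2.2.2 = true}).preimage
        (f := fun u : Qbar → Bool => (u a, u b, u (a * b), u (a + b))) (by fun_prop)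
  · refine isClosed_iInter fun a => ?_
    exact (isClosed_discrete {v : Bool × Bool × Bool | v.1 = true → v.2.1 = true ∧ v.2.2 = true}
      ).preimage (f := fun u : Qbar → Bool => (u a, u (-a), u a⁻¹)) (by fun_prop)

theorem isClosedEmbedding_subfieldIndicator : IsClosedEmbedding subfieldIndicator :=
  ⟨⟨isInducing_subfieldIndicator, injective_subfieldIndicator⟩, isClosed_range_subfieldIndicator⟩

instance : CompactSpace (Subfield Qbar) := isClosedEmbedding_subfieldIndicator.compactSpace

instance : T2Space (Subfield Qbar) := isClosedEmbedding_subfieldIndicator.isEmbedding.t2Space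

theorem isClopen_setOf_mem_subfield (q : Qbar) : IsClopen {F : Subfield Qbar | q ∈ F} := by
  have h : IsClopen {b : Bool | b = true} := isClopen_discrete _
  have := h.preimage ((continuous_apply q).comp isInducing_subfieldIndicator.continuous)
  simpa [Set.preimage] using this

theorem exists_finset_forall_mem_of_isOpen {U : Set (Subfield Qbar)} (hU : IsOpen U)
    {F : Subfield Qbar} (hF : F ∈ U) :
    ∃ A : Finset Qbar, ∀ F' : Subfield Qbar, (∀ q ∈ A, q ∈ F' ↔ q ∈ F) → F' ∈ U := by
  obtain ⟨V, hV, rfl⟩ := isInducing_subfieldIndicator.isOpen_iff.mp hU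
  obtain ⟨A, u, hu, hAV⟩ := isOpen_pi_iff.mp hV _ hF
  refine ⟨A, fun F' h => hAV fun q hq => ?_⟩
  have : subfieldIndicator F' q = subfieldIndicator F q := by
    rw [Bool.eq_iff_iff, subfieldIndicator_eq_true, subfieldIndicator_eq_true]
    exact h q hq
  rw [this]
  exact (hu q hq).2

/-- The subfields over which `g`, if defined over them, has a zero. -/
def zeroSet (g : MvPolynomial (Fin 2) Qbar) : Set (Subfield Qbar) :=
  {F | (g.coeffs : Set Qbar) ⊆ F → ∃ x ∈ F, ∃ y ∈ F, MvPolynomial.eval ![x, y] g = 0}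

theorem isOpen_zeroSet (g : MvPolynomial (Fin 2) Qbar) : IsOpen (zeroSet g) := by
  have h : zeroSet g = (⋂ q ∈ g.coeffs, {F : Subfield Qbar | q ∈ F})ᶜ ∪
      ⋃ (x : Qbar) (y : Qbar) (_ : MvPolynomial.eval ![x, y] g = 0),
        {F : Subfield Qbar | x ∈ F} ∩ {F : Subfield Qbar | y ∈ F} := by
    ext F
    simp only [zeroSet, Set.mem_ofPred_eq, Set.mem_union, Set.mem_compl_iff, Set.mem_iInter,
      Set.mem_iUnion, Set.mem_inter_iff, imp_iff_not_or, Set.subset_def,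
      SetLike.mem_coe]
    refine or_congr Iff.rfl ⟨?_, ?_⟩
    · rintro ⟨x, hx, y, hy, h⟩
      exact ⟨x, y, h, hx, hy⟩
    · rintro ⟨x, y, h, hx, hy⟩
      exact ⟨x, hx, y, hy, h⟩
  rw [h]
  refine IsOpen.union (isOpen_compl_iff.mpr ?_) ?_
  · exact isClosed_biInter fun q _ => (isClopen_setOf_mem_subfield q).isClosed
  · exact isOpen_iUnion fun x => isOpen_iUnion fun y => isOpen_iUnion fun _ =>
      (isClopen_setOf_mem_subfield x).isOpen.inter (isClopen_setOf_mem_subfield y).isOpen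

theorem setOf_isPAC_eq :
    {F : Subfield Qbar | IsPAC F} = ⋂ g : {g : MvPolynomial (Fin 2) Qbar // Irreducible g},
      zeroSet g := by
  ext F
  have hev : ∀ (x y : F) (f : MvPolynomial (Fin 2) F),
      MvPolynomial.eval ![(x : Qbar), y] (MvPolynomial.map F.subtype f) =
        MvPolynomial.eval ![x, y] f := by
    intro x y f
    have : ![(x : Qbar), y] = F.subtype ∘ ![x, y] := by
      funext i; fin_cases i <;> rfl
    rw [this, MvPolynomial.eval_map, ← MvPolynomial.eval₂_comp]
    rfl
  simp only [Set.mem_ofPred_eq, Set.mem_iInter, zeroSet, Subtype.forall]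
  constructor
  · intro h g hg hF
    obtain ⟨f, rfl⟩ := MvPolynomial.mem_range_map_iff_coeffs_subset (f := F.subtype).mpr
      (hF.trans fun q hq => ⟨⟨q, hq⟩, rfl⟩)
    obtain ⟨x, y, hxy⟩ := h f hg
    exact ⟨x, x.2, y, y.2, by rw [hev, hxy]; rfl⟩
  · intro h f hf
    obtain ⟨x, hx, y, hy, hxy⟩ := h _ hf (by
      refine (MvPolynomial.mem_range_map_iff_coeffs_subset.mp ⟨f, rfl⟩).trans ?_
      rintro _ ⟨q, rfl⟩
      exact q.2)
    refine ⟨⟨x, hx⟩, ⟨y, hy⟩, ?_⟩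
    have := (hev ⟨x, hx⟩ ⟨y, hy⟩ f).symm.trans hxy
    exact Subtype.ext this

theorem dense_zeroSet {g : MvPolynomial (Fin 2) Qbar} (hg : Irreducible g) :
    Dense (zeroSet g) := by
  refine dense_iff_inter_open.mpr fun U hU ⟨F, hF⟩ => ?_
  obtain ⟨A, hA⟩ := exists_finset_forall_mem_of_isOpen hU hF
  by_cases hgF : (g.coeffs : Set Qbar) ⊆ F
  swap
  · exact ⟨F, hF, fun h => absurd h hgF⟩
  set S : Set Qbar := (A ∩ F : Set Qbar) ∪ g.coeffs
  have hS : S.Finite := (A.finite_toSet.inter_of_left _).union g.coeffs.finite_toSet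
  have hSF : S ⊆ F := Set.union_subset Set.inter_subset_right hgF
  set K := IntermediateField.adjoin ℚ S
  have hKF : K.toSubfield ≤ F := by
    refine IntermediateField.adjoin_le_subfield ℚ S ?_ hSF
    rintro _ ⟨r, rfl⟩
    rw [eq_ratCast]
    exact SubfieldClass.ratCast_mem F r
  have : Finite S := hS.to_subtype
  have : FiniteDimensional ℚ K := IntermediateField.finiteDimensional_adjoin fun x _ =>
    (Algebra.IsAlgebraic.isAlgebraic x).isIntegral
  obtain ⟨f, hf⟩ := MvPolynomial.mem_range_map_iff_coeffs_subset (f := algebraMap K Qbar).mpr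
    (show (g.coeffs : Set Qbar) ⊆ Set.range (algebraMap K Qbar) from
      fun q hq => ⟨⟨q, IntermediateField.subset_adjoin ℚ S (Or.inr hq)⟩, rfl⟩)
  obtain ⟨p, rfl⟩ := (Bivariate.equivMvPolynomial K).surjective f
  have hp : Irreducible (p.map (mapRingHom (algebraMap K Qbar))) := by
    have hg' := hg
    rw [← hf, map_equivMvPolynomial] at hg'
    exact (MulEquiv.irreducible_iff (Bivariate.equivMvPolynomial Qbar)).mp hg'
  obtain ⟨x, y, hxy, hB⟩ := exists_zero_avoiding p hp (B := (A : Set Qbar) \ F)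
    A.finite_toSet.sdiff (by
      rintro b ⟨-, hbF⟩ ⟨c, rfl⟩
      exact hbF (hKF c.2))
  refine ⟨(IntermediateField.adjoin K {y}).toSubfield, hA _ fun q hq => ?_, fun _ => ?_⟩
  · refine ⟨fun h => ?_, fun h => ?_⟩
    · by_contra hqF
      exact hB q ⟨hq, hqF⟩ h
    · exact IntermediateField.algebraMap_mem (IntermediateField.adjoin K {y})
        ⟨q, IntermediateField.subset_adjoin ℚ S (Or.inl ⟨hq, h⟩)⟩
  · refine ⟨algebraMap K Qbar x, IntermediateField.algebraMap_mem (IntermediateField.adjoin K {y}) x,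
      y, IntermediateField.mem_adjoin_simple_self K y, ?_⟩
    rw [← hf, eval_map_equivMvPolynomial, hxy]

theorem countable_mvPolynomial_Qbar : Countable (MvPolynomial (Fin 2) Qbar) := by
  have h1 : Cardinal.mk Qbar ≤ Cardinal.aleph0 := by
    refine (Algebra.IsAlgebraic.cardinalMk_le_max ℚ Qbar).trans ?_
    simp
  refine Cardinal.mk_le_aleph0_iff.mp ((MvPolynomial.cardinalMk_le_max).trans ?_)
  simp [h1]

end SubfieldSpace

end

/-- The set of PAC subfields of `Q̄` is a dense `G_δ` subset, in particular a comeager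
subset, of the space `𝓔` of all subfields of `Q̄`. -/
theorem pac_dense_Gdelta :
    Dense {F : Subfield Qbar | IsPAC F} ∧ IsGδ {F : Subfield Qbar | IsPAC F} ∧
      {F : Subfield Qbar | IsPAC F} ∈ residual (Subfield Qbar) := by
  have := countable_mvPolynomial_Qbar
  rw [setOf_isPAC_eq]
  have hd : Dense (⋂ g : {g : MvPolynomial (Fin 2) Qbar // Irreducible g}, zeroSet g) :=
    dense_iInter_of_isOpen (fun g => isOpen_zeroSet g) fun g => dense_zeroSet g.2
  have hG : IsGδ (⋂ g : {g : MvPolynomial (Fin 2) Qbar // Irreducible g}, zeroSet g) :=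
    IsGδ.iInter_of_isOpen fun g => isOpen_zeroSet g
  exact ⟨hd, hG, residual_of_dense_Gδ hG hd⟩
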